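/- The L_NFU-sentence (∀n∈ℕ)(beth(T(n)) ≠ ∅ → |M_n| ≤ beth(T(n))) holds in every model of NFU^{-AC}, where M_n denotes the rank-(ω+n) initial segment E^{ω+n} of the structure ⟨BF, E⟩ and κ ≤ μ means there are X ∈ κ and Y ∈ μ with an injection from X into Y. -/

import Mathlib

open FirstOrder Language

namespace NFUweak

/-! ## The language L_NFU -/

/-- Function symbols of `L_NFU`: a single binary (type-level) pairing function. -/
inductive NFUFunc : ℕ → Type
  | pair : NFUFunc 2

/-- Relation symbols of `L_NFU`: binary membership `∈` and unary sethood `S`. -/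
inductive NFURel : ℕ → Type
  | mem : NFURel 2
  | isSet : NFURel 1

/-- The language `L_NFU`. -/
def LNFU : Language := ⟨NFUFunc, NFURel⟩

/-- The membership relation symbol. -/
def memR : LNFU.Relations 2 := NFURel.mem

/-- The sethood relation symbol. -/
def setR : LNFU.Relations 1 := NFURel.isSet

/-- The pairing function symbol. -/
def pairF : LNFU.Functions 2 := NFUFunc.pair

/-! ## Stratification -/

/-- `termLevel σ t k` says that, relative to the assignment `σ` of levels (types)
to variables, the term `t` (and all of its subterms) receives level `k`. -/
def termLevel {α : Type} (σ : α → ℕ) : LNFU.Term α → ℕ → Prop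
  | Term.var v, k => σ v = k
  | Term.func _ ts, k => ∀ i, termLevel σ (ts i) k

/-- The stratification condition on an atomic formula `R(ts)`:
for `s ∈ t` the level of `t` is one more than that of `s`; `S(t)` imposes only
that `t` has a well-defined level. -/
def atomOK {α : Type} (σ : α → ℕ) : ∀ {l : ℕ}, LNFU.Relations l → (Fin l → LNFU.Term α) → Prop
  | _, NFURel.mem, ts => ∃ k, termLevel σ (ts 0) k ∧ termLevel σ (ts 1) (k + 1)
  | _, NFURel.isSet, ts => ∃ k, termLevel σ (ts 0) k

/-- `stratifiedFrom σ φ` : the formula `φ` is stratified, where the free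
variables receive the levels given by `σ` (each quantified variable may receive
any level). -/
def stratifiedFrom : ∀ {n : ℕ}, ((Empty ⊕ Fin n) → ℕ) → LNFU.BoundedFormula Empty n → Prop
  | _, _, BoundedFormula.falsum => True
  | _, σ, BoundedFormula.equal t s => ∃ k, termLevel σ t k ∧ termLevel σ s k
  | _, σ, BoundedFormula.rel R ts => atomOK σ R ts
  | _, σ, BoundedFormula.imp f g => stratifiedFrom σ f ∧ stratifiedFrom σ g
  | _, σ, BoundedFormula.all f =>
      ∃ k, stratifiedFrom
        (Sum.elim (fun e => σ (Sum.inl e)) (Fin.snoc (fun i => σ (Sum.inr i)) k)) f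

/-- A formula of `L_NFU` is stratified if some assignment of levels to its
variables witnesses the stratification conditions. -/
def IsStratified {n : ℕ} (φ : LNFU.BoundedFormula Empty n) : Prop :=
  ∃ σ, stratifiedFrom σ φ

/-! ## The axioms of NFU⁻ᴬᶜ -/

/-- Weak extensionality: sets with the same members are equal. -/
def weakExtAx : LNFU.Sentence :=
  ∀' ∀' ((setR.boundedFormula₁ &0 ⊓
          setR.boundedFormula₁ &1) ⟹
    (Term.bdEqual &0 &1 ⇔
      ∀' (memR.boundedFormula₂ &2 &0 ⇔
          memR.boundedFormula₂ &2 &1)))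

/-- The pairing axiom: `⟨x,y⟩ = ⟨w,z⟩ → x = w ∧ y = z`. -/
def pairingAx : LNFU.Sentence :=
  ∀' ∀' ∀' ∀' (Term.bdEqual
      (pairF.apply₂ &0 &1)
      (pairF.apply₂ &2 &3) ⟹
    (Term.bdEqual &0 &2 ⊓ Term.bdEqual &1 &3))

/-- The comprehension axiom for a formula `φ(x, z₀, …, z_{m-1})`, where the
variable `x` is (de Bruijn) variable `m` of `φ` and `z₀, …, z_{m-1}` are the
parameters: `∀ z⃗ ∃ y (S(y) ∧ ∀ x (x ∈ y ↔ φ(x, z⃗)))`. -/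
def comprehensionAx (m : ℕ) (φ : LNFU.BoundedFormula Empty (m + 1)) : LNFU.Sentence :=
  BoundedFormula.alls (∃'
    (setR.boundedFormula₁ (Term.var (Sum.inr ⟨m, by omega⟩)) ⊓
      ∀' (memR.boundedFormula₂
            (Term.var (Sum.inr ⟨m + 1, by omega⟩)) (Term.var (Sum.inr ⟨m, by omega⟩)) ⇔
          φ.liftAt 1 m)))

/-- The theory NFU⁻ᴬᶜ : weak extensionality, pairing and stratified comprehension. -/
def NFUmAC : LNFU.Theory :=
  {weakExtAx, pairingAx} ∪
    {s | ∃ (m : ℕ) (φ : LNFU.BoundedFormula Empty (m + 1)),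
      IsStratified φ ∧ s = comprehensionAx m φ}

/-- The axiom `∀x S(x)` ("everything is a set"), turning NFU⁻ᴬᶜ into NF. -/
def allSetAx : LNFU.Sentence :=
  ∀' (setR.boundedFormula₁ &0)

/-- The theory NF. -/
def NF : LNFU.Theory := NFUmAC ∪ {allSetAx}

end NFUweak
namespace NFUweak

/-! ## Semantic notions inside a model of NFU⁻ᴬᶜ -/

section Semantics

variable {M : Type} [LNFU.Structure M]

/-- The membership relation of the model. -/
def smem (x y : M) : Prop := Structure.RelMap memR ![x, y]

/-- The sethood predicate of the model. -/
def sset (x : M) : Prop := Structure.RelMap setR ![x]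

/-- The (type-level) pairing function of the model. -/
def spair (x y : M) : M := Structure.funMap pairF ![x, y]

/-- `s` is the singleton `{x}`. -/
def isSingletonOf (s x : M) : Prop := sset s ∧ ∀ z, smem z s ↔ z = x

/-- `e` is the empty set. -/
def isEmptySet (e : M) : Prop := sset e ∧ ∀ z, ¬ smem z e

/-- `v` is the universal set `V`. -/
def isUniverseOf (v : M) : Prop := sset v ∧ ∀ x, smem x v

/-- `f` is an internal function from (the members of) `X` to `Y`, coded as a set of
type-level ordered pairs `⟨a, b⟩`. -/
def isFunc (f X Y : M) : Prop :=
  sset f ∧ (∀ p, smem p f → ∃ a b, p = spair a b ∧ smem a X ∧ smem b Y) ∧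
    (∀ a, smem a X → ∃ b, smem (spair a b) f) ∧
    (∀ a b b', smem (spair a b) f → smem (spair a b') f → b = b')

/-- `f` is an internal injection from `X` into `Y`. -/
def isInjFunc (f X Y : M) : Prop :=
  isFunc f X Y ∧ ∀ a a' b, smem (spair a b) f → smem (spair a' b) f → a = a'

/-- `f` is an internal bijection between `X` and `Y`. -/
def isBijFunc (f X Y : M) : Prop :=
  isInjFunc f X Y ∧ ∀ b, smem b Y → ∃ a, smem (spair a b) f

/-- `X` and `Y` are equipollent (internally). -/
def equipollent (X Y : M) : Prop := ∃ f, isBijFunc f X Y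

/-- `c` is the cardinal `|X|`, i.e. the equivalence class of `X` under equipollence. -/
def isCardOf (c X : M) : Prop := sset c ∧ ∀ y, smem y c ↔ equipollent y X

/-- `c` is a cardinal. -/
def isCardinal (c : M) : Prop := ∃ X, sset X ∧ isCardOf c X

/-- `κ ≤ μ` for cardinals: some member of `κ` injects into some member of `μ`. -/
def cardLe (κ μ : M) : Prop := ∃ X Y f, smem X κ ∧ smem Y μ ∧ isInjFunc f X Y

/-- `Y = ι``X` is the set of singletons of members of `X`. -/
def isIotaImageOf (Y X : M) : Prop :=
  sset Y ∧ ∀ z, smem z Y ↔ ∃ x, smem x X ∧ isSingletonOf z x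

/-- `t = T(c)` for a cardinal `c`:  `T(|X|) = |ι``X|`. -/
def isTOf (t c : M) : Prop :=
  ∃ X Y, smem X c ∧ isIotaImageOf Y X ∧ isCardOf t Y

/-- `t = T⁴(c)`. -/
def isT4Of (t c : M) : Prop :=
  ∃ t₁ t₂ t₃, isTOf t₁ c ∧ isTOf t₂ t₁ ∧ isTOf t₃ t₂ ∧ isTOf t t₃

/-- `z` is the cardinal `0`, the set of all objects with no members. -/
def isZeroCard (z : M) : Prop := sset z ∧ ∀ y, smem y z ↔ ∀ w, ¬ smem w y

/-- `s = S(x)` is the cardinal successor:  `S(x) = {y : (∃z∈y)(y∖{z} ∈ x)}`. -/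
def isSuccOf (s x : M) : Prop :=
  sset s ∧ ∀ y, smem y s ↔
    ∃ z, smem z y ∧ ∃ d, sset d ∧ (∀ w, smem w d ↔ (smem w y ∧ w ≠ z)) ∧ smem d x

/-- `o` is the cardinal `1 = S(0)`. -/
def isOneCard (o : M) : Prop := ∃ z, isZeroCard z ∧ isSuccOf o z

/-- `I` is an inductive set: it contains `0` and is closed under `S`. -/
def isInductiveSet (I : M) : Prop :=
  sset I ∧ (∀ z, isZeroCard z → smem z I) ∧ ∀ a b, smem a I → isSuccOf b a → smem b I

/-- `n` is an internal natural number: it belongs to every inductive set. -/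
def isNat (n : M) : Prop := ∀ I, isInductiveSet I → smem n I

/-- `N` is the set `ℕ` of internal natural numbers. -/
def isNatSet (N : M) : Prop := sset N ∧ ∀ y, smem y N ↔ isNat y

/-- `m + k = n` on cardinals, via disjoint unions. -/
def cardAdd (m k n : M) : Prop :=
  ∃ x y u, smem x m ∧ smem y k ∧ (∀ w, ¬ (smem w x ∧ smem w y)) ∧
    sset u ∧ (∀ w, smem w u ↔ (smem w x ∨ smem w y)) ∧ smem u n

/-- `P` is the cartesian product `x × y` (with type-level pairs). -/
def isProdOf (P x y : M) : Prop :=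
  sset P ∧ ∀ p, smem p P ↔ ∃ a b, smem a x ∧ smem b y ∧ p = spair a b

/-- `k · m = n` on cardinals, via cartesian products. -/
def cardMul (k m n : M) : Prop :=
  ∃ x y P, smem x k ∧ smem y m ∧ isProdOf P x y ∧ smem P n

/-- `m ≤ n` on internal natural numbers: `∃k∈ℕ, m + k = n`. -/
def natLe (m n : M) : Prop := ∃ k, isNat k ∧ cardAdd m k n

/-- The model satisfies `AxCount₍≥₎ : (∀n∈ℕ)(T(n) ≤ n)`. -/
def axCountGeqHolds (M : Type) [LNFU.Structure M] : Prop :=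
  ∀ n : M, isNat n → ∀ t, isTOf t n → natLe t n

/-- The model satisfies `AxCount₍≤₎ : (∀n∈ℕ)(n ≤ T(n))`. -/
def axCountLeqHolds (M : Type) [LNFU.Structure M] : Prop :=
  ∀ n : M, isNat n → ∀ t, isTOf t n → natLe n t

/-- The model satisfies `AxCount : (∀n∈ℕ)(T(n) = n)`. -/
def axCountHolds (M : Type) [LNFU.Structure M] : Prop :=
  ∀ n : M, isNat n → ∀ t, isTOf t n → t = n

/-- The model satisfies the Axiom of Choice: every set of pairwise disjoint
nonempty sets has a transversal. -/
def acHolds (M : Type) [LNFU.Structure M] : Prop :=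
  ∀ X : M, sset X →
    (∀ y, smem y X → sset y ∧ ∃ z, smem z y) →
    (∀ y y', smem y X → smem y' X → y ≠ y' → ∀ z, ¬ (smem z y ∧ smem z y')) →
    ∃ t, sset t ∧ ∀ y, smem y X → ∃! z, smem z y ∧ smem z t

/-- `2^κ` is defined (i.e. `2^κ ≠ ∅`): there is a set `X` with `|ι``X| = κ`. -/
def twoPowDefined (κ : M) : Prop := ∃ X Y, isIotaImageOf Y X ∧ isCardOf κ Y

/-- `P` is the power set of `X`. -/
def isPowerSetOf (P X : M) : Prop :=
  sset P ∧ ∀ z, smem z P ↔ (sset z ∧ ∀ w, smem w z → smem w X)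

/-- `μ = 2^κ` (in the nonempty case): `μ = |P(X)|` for some `X` with `|ι``X| = κ`. -/
def isTwoPowOf (μ κ : M) : Prop :=
  ∃ X Y P, isIotaImageOf Y X ∧ isCardOf κ Y ∧ isPowerSetOf P X ∧ isCardOf μ P

/-- `f` is the internal function `beth : ℕ → NC ∪ {∅}` with `beth(0) = ℵ₀` and
`beth(n+1) = 2^{beth(n)}` (with value `∅` once undefined). -/
def isBethFun (f : M) : Prop :=
  sset f ∧
    (∀ p, smem p f → ∃ n y, isNat n ∧ p = spair n y) ∧
    (∀ n, isNat n → ∃ y, smem (spair n y) f) ∧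
    (∀ n y y', smem (spair n y) f → smem (spair n y') f → y = y') ∧
    (∀ z y, isZeroCard z → smem (spair z y) f → ∃ N, isNatSet N ∧ isCardOf y N) ∧
    (∀ n n' y y', isNat n → isSuccOf n' n →
      smem (spair n y) f → smem (spair n' y') f →
        ((isEmptySet y ∧ isEmptySet y') ∨
          (¬ isEmptySet y ∧
            (isTwoPowOf y' y ∨ (isEmptySet y' ∧ ¬ twoPowDefined y)))))

end Semantics

end NFUweak
namespace NFUweak

/-! ## BFEXTs and the structure ⟨BF, E⟩ inside a model of NFU⁻ᴬᶜ -/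

section BF

variable {M : Type} [LNFU.Structure M]

/-- `R` is an internal binary relation: a set of (type-level) ordered pairs. -/
def isRel (R : M) : Prop := sset R ∧ ∀ p, smem p R → ∃ x y, p = spair x y

/-- `x` belongs to the field `Dom(R) = dom(R) ∪ rng(R)` of the relation `R`. -/
def inField (x R : M) : Prop := ∃ y, smem (spair x y) R ∨ smem (spair y x) R

/-- `D` is the field `Dom(R)` of `R`, as a set. -/
def isFieldSetOf (D R : M) : Prop := sset D ∧ ∀ x, smem x D ↔ inField x R

/-- `R` is a BFEXT: a binary relation that is well-founded (every nonempty
subset of its field has an `R`-minimal element) and extensional. -/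
def isBFEXT (R : M) : Prop :=
  isRel R ∧
    (∀ B, sset B → (∃ b, smem b B) → (∀ b, smem b B → inField b R) →
      ∃ b, smem b B ∧ ∀ c, smem c B → ¬ smem (spair c b) R) ∧
    (∀ a b, inField a R → inField b R →
      (∀ c, smem (spair c a) R ↔ smem (spair c b) R) → a = b)

/-- `x` belongs to the smallest subset of `Dom(R)` containing `a` and closed
under `R`-predecessors. -/
def inSeg (x R a : M) : Prop :=
  ∀ B, sset B → (∀ b, smem b B → inField b R) → smem a B →
    (∀ b c, smem b B → smem (spair c b) R → smem c B) → smem x B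

/-- `s = seg_R(a)`: the restriction of `R` to the smallest subset of `Dom(R)`
containing `a` and closed under `R`-predecessors. -/
def isSegOf (s R a : M) : Prop :=
  sset s ∧ ∀ p, smem p s ↔
    (smem p R ∧ ∃ x y, p = spair x y ∧ inSeg x R a ∧ inSeg y R a)

/-- `R ∈ Ω`: `R` is a BFEXT with `R = seg_R(a)` for some `a ∈ Dom(R)`. -/
def inOmega (R : M) : Prop := isBFEXT R ∧ ∃ a, inField a R ∧ isSegOf R R a

/-- `a = 1_R` is the (unique) top of `R ∈ Ω`. -/
def isTopOf (a R : M) : Prop := inField a R ∧ isSegOf R R a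

/-- `f` is an internal isomorphism between the relations `R` and `S`. -/
def isIsoRel (f R S : M) : Prop :=
  sset f ∧
    (∀ p, smem p f → ∃ x y, p = spair x y ∧ inField x R ∧ inField y S) ∧
    (∀ x, inField x R → ∃ y, smem (spair x y) f) ∧
    (∀ x y y', smem (spair x y) f → smem (spair x y') f → y = y') ∧
    (∀ x x' y, smem (spair x y) f → smem (spair x' y) f → x = x') ∧
    (∀ y, inField y S → ∃ x, smem (spair x y) f) ∧
    (∀ x y x' y', smem (spair x x') f → smem (spair y y') f →
      (smem (spair x y) R ↔ smem (spair x' y') S))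

/-- `R` and `S` are isomorphic relations. -/
def relIso (R S : M) : Prop := ∃ f, isIsoRel f R S

/-- `t = [R]` is the set of all relations isomorphic to `R`. -/
def isTypeOf (t R : M) : Prop := sset t ∧ ∀ S, smem S t ↔ relIso S R

/-- `a ∈ BF`: `a = [R]` for some `R ∈ Ω`. -/
def inBF (a : M) : Prop := ∃ R, inOmega R ∧ isTypeOf a R

/-- `a E b` for `a, b ∈ BF`: for `R ∈ a`, `S ∈ b` there is `x ∈ Dom(S)` with
`⟨x, 1_S⟩ ∈ S` and `R ≅ seg_S(x)`. -/
def erel (a b : M) : Prop :=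
  ∃ R S, smem R a ∧ smem S b ∧
    ∃ x oneS, isTopOf oneS S ∧ smem (spair x oneS) S ∧
      ∃ sg, isSegOf sg S x ∧ relIso R sg

/-- `e` is the set `E ⊆ BF × BF`. -/
def isESet (e : M) : Prop :=
  sset e ∧ ∀ p, smem p e ↔ ∃ a b, p = spair a b ∧ inBF a ∧ inBF b ∧ erel a b

/-- `R' = T(R)`: the relation `{⟨{x},{y}⟩ : ⟨x,y⟩ ∈ R}`. -/
def isTRelOf (R' R : M) : Prop :=
  sset R' ∧ ∀ p, smem p R' ↔
    ∃ x y sx sy, smem (spair x y) R ∧ isSingletonOf sx x ∧ isSingletonOf sy y ∧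
      p = spair sx sy

/-- `t' = T(t)` for (isomorphism) types `t` of well-founded relations:
`T([R]) = [{⟨{x},{y}⟩ : ⟨x,y⟩ ∈ R}]`. -/
def isTTypeOf (t' t : M) : Prop :=
  ∃ R R', smem R t ∧ isTRelOf R' R ∧ isTypeOf t' R'

/-- `y = M₀ = E^ω`, the set of types of BFEXTs with finite domain. -/
def isM0Set (y : M) : Prop :=
  sset y ∧ ∀ a, smem a y ↔
    (inBF a ∧ ∃ R D c, smem R a ∧ isFieldSetOf D R ∧ isCardOf c D ∧ isNat c)

/-- `g` is the internal function `n ↦ M_n = E^{ω+n}` on the internal naturals: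
`M_0 = E^ω` and `M_{n+1} = {a ∈ BF : every E-predecessor of a lies in M_n}`. -/
def isMFun (g : M) : Prop :=
  sset g ∧
    (∀ p, smem p g → ∃ n y, isNat n ∧ p = spair n y) ∧
    (∀ n, isNat n → ∃ y, smem (spair n y) g) ∧
    (∀ n y y', smem (spair n y) g → smem (spair n y') g → y = y') ∧
    (∀ z y, isZeroCard z → smem (spair z y) g → isM0Set y) ∧
    (∀ n n' y y', isNat n → isSuccOf n' n →
      smem (spair n y) g → smem (spair n' y') g →
        (sset y' ∧ ∀ a, smem a y' ↔ (inBF a ∧ ∀ b, inBF b → erel b a → smem b y)))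

end BF

end NFUweak
namespace NFUweak

/-! ## The Simple Theory of Types with Infinity (TSTI) -/

/-- Formulae of the many-sorted language `L_TST`, with named variables:
`mem n i j` is `x^n_i ∈_n x^{n+1}_j`, `eq n i j` is `x^n_i = x^n_j`, and
`all n i φ` is `∀ x^n_i, φ`. -/
inductive TSTFormula : Type
  | mem (n i j : ℕ)
  | eq (n i j : ℕ)
  | fal
  | imp (φ ψ : TSTFormula)
  | all (n i : ℕ) (φ : TSTFormula)

/-- Update a many-sorted valuation at variable `x^n_i`. -/
def tstUpd {M : ℕ → Type} (v : ∀ n, ℕ → M n) (n i : ℕ) (a : M n) : ∀ m, ℕ → M m :=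
  fun m j => if h : m = n ∧ j = i then (congrArg M h.1).symm ▸ a else v m j

/-- Satisfaction of an `L_TST`-formula in the many-sorted structure `⟨M, E⟩`
under the valuation `v`. -/
def TSTFormula.Realize {M : ℕ → Type} (E : ∀ n, M n → M (n + 1) → Prop) :
    TSTFormula → (∀ n, ℕ → M n) → Prop
  | .mem n i j, v => E n (v n i) (v (n + 1) j)
  | .eq n i j, v => v n i = v n j
  | .fal, _ => False
  | .imp φ ψ, v => φ.Realize E v → ψ.Realize E v
  | .all n i φ, v => ∀ a : M n, φ.Realize E (tstUpd v n i a)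

/-- All sorts mentioned in the formula are `< k` (so it is an `L_k`-formula). -/
def TSTFormula.sortsLT : TSTFormula → ℕ → Prop
  | .mem n _ _, k => n + 1 < k
  | .eq n _ _, k => n < k
  | .fal, _ => True
  | .imp φ ψ, k => φ.sortsLT k ∧ ψ.sortsLT k
  | .all n _ φ, k => n < k ∧ φ.sortsLT k

/-- `p : M 2` is the Kuratowski ordered pair `⟨a, b⟩ = {{a},{a,b}}`. -/
def isKPair {M : ℕ → Type} (E : ∀ n, M n → M (n + 1) → Prop)
    (p : M 2) (a b : M 0) : Prop :=
  ∀ s : M 1, E 1 s p ↔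
    ((∀ z, E 0 z s ↔ z = a) ∨ (∀ z, E 0 z s ↔ (z = a ∨ z = b)))

/-- The axiom of Infinity: there are `x¹` and `f³` such that `f³` codes an
injective, non-surjective function from `x¹` to `x¹` (with Kuratowski pairs). -/
def TSTInfinity {M : ℕ → Type} (E : ∀ n, M n → M (n + 1) → Prop) : Prop :=
  ∃ (X : M 1) (f : M 3),
    (∀ p : M 2, E 2 p f → ∃ a b, E 0 a X ∧ E 0 b X ∧ isKPair E p a b) ∧
    (∀ a, E 0 a X → ∃ b p, E 0 b X ∧ E 2 p f ∧ isKPair E p a b) ∧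
    (∀ a b b' p p', E 2 p f → E 2 p' f → isKPair E p a b → isKPair E p' a b' → b = b') ∧
    (∀ a a' b p p', E 2 p f → E 2 p' f → isKPair E p a b → isKPair E p' a' b → a = a') ∧
    (∃ b, E 0 b X ∧ ∀ a p, E 2 p f → ¬ isKPair E p a b)

/-- `⟨M, E⟩` is a model of TSTI: all sorts are nonempty and Extensionality,
Comprehension (for every `L_TST`-formula) and Infinity hold. -/
def IsTSTIModel (M : ℕ → Type) (E : ∀ n, M n → M (n + 1) → Prop) : Prop :=
  (∀ n, Nonempty (M n)) ∧
    (∀ n, ∀ x y : M (n + 1), (∀ z, E n z x ↔ E n z y) → x = y) ∧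
    (∀ (φ : TSTFormula) (n i : ℕ) (v : ∀ m, ℕ → M m),
      ∃ y : M (n + 1), ∀ x : M n, E n x y ↔ φ.Realize E (tstUpd v n i x)) ∧
    TSTInfinity E

/-- `⟨M, E⟩` is a model of the fragment TSTI_k, which only refers to the sorts
`< k` (so `k ≥ 4` is needed for the axiom of Infinity to be expressible). -/
def IsTSTIModelBelow (k : ℕ) (M : ℕ → Type) (E : ∀ n, M n → M (n + 1) → Prop) : Prop :=
  (∀ n, n < k → Nonempty (M n)) ∧
    (∀ n, n + 1 < k → ∀ x y : M (n + 1), (∀ z, E n z x ↔ E n z y) → x = y) ∧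
    (∀ (φ : TSTFormula), φ.sortsLT k → ∀ (n i : ℕ), n + 1 < k →
      ∀ v : ∀ m, ℕ → M m,
        ∃ y : M (n + 1), ∀ x : M n, E n x y ↔ φ.Realize E (tstUpd v n i x)) ∧
    TSTInfinity E

/-! ## The language of arithmetic and the internal arithmetic of a model -/

/-- Function symbols of `L_PA`: `0`, `1`, `+` and `·`. -/
inductive PAFunc : ℕ → Type
  | zero : PAFunc 0
  | one : PAFunc 0
  | add : PAFunc 2
  | mul : PAFunc 2

/-- The language `L_PA` of arithmetic. -/
def LPA : Language := ⟨PAFunc, fun _ => Empty⟩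

/-- The type of internal natural numbers of a model of NFU⁻ᴬᶜ. -/
def NatSub (M : Type) [LNFU.Structure M] : Type := {n : M // isNat n}

/-- An `L_PA`-structure on the internal natural numbers of `M` is the internal
arithmetic if its operations are given by the internal graphs of `0`, `1`,
cardinal addition and cardinal multiplication. -/
def InternalArithOn (M : Type) [LNFU.Structure M] (A : LPA.Structure (NatSub M)) : Prop :=
  isZeroCard (A.funMap PAFunc.zero ![]).val ∧
    isOneCard (A.funMap PAFunc.one ![]).val ∧
    (∀ a b : NatSub M, cardAdd a.val b.val (A.funMap PAFunc.add ![a, b]).val) ∧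
    (∀ a b : NatSub M, cardMul a.val b.val (A.funMap PAFunc.mul ![a, b]).val)

/-- `φ^ℕ` holds in `M`: the sentence `φ` of `L_PA` is true in the internal
arithmetic `⟨ℕ, +, ·, 0, 1⟩` of `M`. -/
def internalPASat (M : Type) [LNFU.Structure M] (φ : LPA.Sentence) : Prop :=
  ∀ A : LPA.Structure (NatSub M), InternalArithOn M A →
    @Sentence.Realize LPA (NatSub M) A φ

end NFUweak
namespace NFUweak
/-! ## Stratified predicates, semantically -/

/-- Contexts: types of environments together with levels for their entries. -/
inductive Cx (M : Type) : Type → Type 1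
  | nil : Cx M Unit
  | cons {E : Type} (Γ : Cx M E) (k : ℕ) : Cx M (E × M)

/-- `TT Γ t k`: the map `t` is given by a term of level `k` (with parameters). -/
inductive TT {M : Type} [LNFU.Structure M] : {E : Type} → Cx M E → (E → M) → ℕ → Prop
  | const {E : Type} (Γ : Cx M E) (c : M) (k : ℕ) : TT Γ (fun _ => c) k
  | var {E : Type} {Γ : Cx M E} {k : ℕ} : TT (Γ.cons k) (fun e => e.2) k
  | lift {E : Type} {Γ : Cx M E} {j k : ℕ} {t : E → M} : TT Γ t k →
      TT (Γ.cons j) (fun e => t e.1) k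
  | pair {E : Type} {Γ : Cx M E} {k : ℕ} {s t : E → M} : TT Γ s k → TT Γ t k →
      TT Γ (fun e => spair (s e) (t e)) k

/-- `SF Γ P`: the predicate `P` is given by a stratified formula (with parameters). -/
inductive SF {M : Type} [LNFU.Structure M] : {E : Type} → Cx M E → (E → Prop) → Prop
  | fls {E : Type} {Γ : Cx M E} : SF Γ (fun _ => False)
  | mem {E : Type} {Γ : Cx M E} {k : ℕ} {s t : E → M} : TT Γ s k → TT Γ t (k + 1) →
      SF Γ (fun e => smem (s e) (t e))
  | set {E : Type} {Γ : Cx M E} {k : ℕ} {s : E → M} : TT Γ s k → SF Γ (fun e => sset (s e))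
  | eq {E : Type} {Γ : Cx M E} {k : ℕ} {s t : E → M} : TT Γ s k → TT Γ t k →
      SF Γ (fun e => s e = t e)
  | imp {E : Type} {Γ : Cx M E} {P Q : E → Prop} : SF Γ P → SF Γ Q →
      SF Γ (fun e => P e → Q e)
  | all {E : Type} {Γ : Cx M E} {k : ℕ} {P : E → M → Prop} :
      SF (Γ.cons k) (fun e => P e.1 e.2) → SF Γ (fun e => ∀ x, P e x)

/-- Number of variables of a context over `l` parameters. -/
def Cx.depth {M : Type} (l : ℕ) : {E : Type} → Cx M E → ℕ
  | _, .nil => l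
  | _, .cons Γ _ => Cx.depth l Γ + 1

/-- The valuation vector of an environment. -/
def Cx.vec {M : Type} {l : ℕ} (c : Fin l → M) :
    {E : Type} → (Γ : Cx M E) → E → (Fin (Cx.depth l Γ) → M)
  | _, .nil, _ => c
  | _, .cons Γ _, e => Fin.snoc (Cx.vec c Γ e.1) e.2

/-- The level vector of a context. -/
def Cx.lev {M : Type} {l : ℕ} (c : Fin l → ℕ) :
    {E : Type} → (Γ : Cx M E) → (Fin (Cx.depth l Γ) → ℕ)
  | _, .nil => c
  | _, .cons Γ k => Fin.snoc (Cx.lev c Γ) k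

theorem termLevel_relabel {α β : Type} (g : α → β) (σ : β → ℕ) (u : LNFU.Term α) (k : ℕ) :
    termLevel σ (u.relabel g) k ↔ termLevel (σ ∘ g) u k := by
  induction u with
  | var v => rfl
  | func f ts ih => exact forall_congr' fun i => ih i

/-- The combined level assignment. -/
def slev {M : Type} (L : List (M × ℕ)) {E : Type} (Γ : Cx M E) :
    Empty ⊕ Fin (Cx.depth L.length Γ) → ℕ :=
  Sum.elim Empty.elim (Cx.lev (fun i => (L.get i).2) Γ)

/-- The combined valuation. -/
def sval {M : Type} (L : List (M × ℕ)) {E : Type} (Γ : Cx M E) (e : E) :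
    Fin (Cx.depth L.length Γ) → M :=
  Cx.vec (fun i => (L.get i).1) Γ e

section Sound
variable {M : Type} [LNFU.Structure M]

theorem const_sound {E : Type} (Γ : Cx M E) (c : M) (k : ℕ) (L : List (M × ℕ)) (h : (c, k) ∈ L) :
    ∃ i : Fin (Cx.depth L.length Γ), Cx.lev (fun i => (L.get i).2) Γ i = k ∧
      ∀ e, Cx.vec (fun i => (L.get i).1) Γ e i = c := by
  induction Γ with
  | nil =>
    obtain ⟨i, hi⟩ := List.get_of_mem h
    exact ⟨i, congrArg Prod.snd hi, fun e => congrArg Prod.fst hi⟩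
  | cons Γ j ih =>
    obtain ⟨i, h1, h2⟩ := ih
    exact ⟨Fin.castSucc i, (Fin.snoc_castSucc (α := fun _ => ℕ) _ _ _).trans h1,
      fun e => (Fin.snoc_castSucc (α := fun _ => M) _ _ _).trans (h2 e.1)⟩

theorem TT.sound {E : Type} {Γ : Cx M E} {t : E → M} {k : ℕ} (h : TT Γ t k) :
    ∃ L0 : List (M × ℕ), ∀ L : List (M × ℕ), L0 ⊆ L →
      ∃ u : LNFU.Term (Empty ⊕ Fin (Cx.depth L.length Γ)), termLevel (slev L Γ) u k ∧
        ∀ e, u.realize (Sum.elim (default : Empty → M) (sval L Γ e)) = t e := by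
  induction h with
  | const Γ c k =>
    refine ⟨[(c, k)], fun L hL => ?_⟩
    obtain ⟨i, h1, h2⟩ := const_sound Γ c k L (hL (by simp))
    exact ⟨Term.var (Sum.inr i), h1, h2⟩
  | @var E Γ k =>
    refine ⟨[], fun L hL => ?_⟩
    exact ⟨Term.var (Sum.inr (Fin.last _)), Fin.snoc_last (α := fun _ => ℕ) _ _,
      fun e => Fin.snoc_last (α := fun _ => M) _ _⟩
  | @lift E Γ j k t _ ih =>
    obtain ⟨L0, h0⟩ := ih
    refine ⟨L0, fun L hL => ?_⟩
    obtain ⟨u, h1, h2⟩ := h0 L hL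
    have key : ∃ u' : LNFU.Term (Empty ⊕ Fin (Cx.depth L.length Γ + 1)),
        termLevel (Sum.elim Empty.elim
          (Fin.snoc (Cx.lev (fun i => (L.get i).2) Γ) j : Fin (Cx.depth L.length Γ + 1) → ℕ)) u' k ∧
        ∀ e : E × M, u'.realize (Sum.elim (default : Empty → M)
          (Fin.snoc (Cx.vec (fun i => (L.get i).1) Γ e.1) e.2 :
            Fin (Cx.depth L.length Γ + 1) → M)) = t e.1 := by
      refine ⟨u.relabel (Sum.map id Fin.castSucc), ?_, fun e => ?_⟩
      · rw [termLevel_relabel]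
        have : (Sum.elim Empty.elim (Fin.snoc (Cx.lev (fun i => (L.get i).2) Γ) j :
            Fin (Cx.depth L.length Γ + 1) → ℕ)) ∘ Sum.map id Fin.castSucc = slev L Γ := by
          funext x
          rcases x with x | x
          · exact x.elim
          · exact Fin.snoc_castSucc (α := fun _ => ℕ) _ _ _
        rw [this]
        exact h1
      · rw [Term.realize_relabel, ← h2 e.1]
        congr 1
        funext x
        rcases x with x | x
        · exact x.elim
        · exact Fin.snoc_castSucc (α := fun _ => M) _ _ _
    exact key
  | @pair E Γ k s t _ _ ih1 ih2 =>
    obtain ⟨L1, h1⟩ := ih1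
    obtain ⟨L2, h2⟩ := ih2
    refine ⟨L1 ++ L2, fun L hL => ?_⟩
    obtain ⟨u1, a1, b1⟩ := h1 L (fun x hx => hL (List.mem_append_left _ hx))
    obtain ⟨u2, a2, b2⟩ := h2 L (fun x hx => hL (List.mem_append_right _ hx))
    refine ⟨Term.func pairF ![u1, u2], ?_, fun e => ?_⟩
    · intro i
      refine Fin.cases ?_ (fun i => ?_) i
      · exact a1
      · have : i = 0 := Subsingleton.elim _ _
        subst this
        exact a2
    · show Structure.funMap pairF _ = Structure.funMap pairF _
      congr 1
      funext i
      refine Fin.cases ?_ (fun i => ?_) i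
      · exact b1 e
      · have : i = 0 := Subsingleton.elim _ _
        subst this
        exact b2 e

theorem SF.sound {E : Type} {Γ : Cx M E} {P : E → Prop} (h : SF Γ P) :
    ∃ L0 : List (M × ℕ), ∀ L : List (M × ℕ), L0 ⊆ L →
      ∃ φ : LNFU.BoundedFormula Empty (Cx.depth L.length Γ), stratifiedFrom (slev L Γ) φ ∧
        ∀ e, φ.Realize (default : Empty → M) (sval L Γ e) ↔ P e := by
  induction h with
  | fls => exact ⟨[], fun L _ => ⟨BoundedFormula.falsum, trivial, fun e => Iff.rfl⟩⟩
  | @mem E Γ k s t hs ht =>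
    obtain ⟨L1, h1⟩ := hs.sound
    obtain ⟨L2, h2⟩ := ht.sound
    refine ⟨L1 ++ L2, fun L hL => ?_⟩
    obtain ⟨u1, a1, b1⟩ := h1 L (fun x hx => hL (List.mem_append_left _ hx))
    obtain ⟨u2, a2, b2⟩ := h2 L (fun x hx => hL (List.mem_append_right _ hx))
    refine ⟨memR.boundedFormula₂ u1 u2, ⟨k, a1, a2⟩, fun e => ?_⟩
    rw [BoundedFormula.realize_rel₂, b1, b2]; rfl
  | @set E Γ k s hs =>
    obtain ⟨L1, h1⟩ := hs.sound
    refine ⟨L1, fun L hL => ?_⟩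
    obtain ⟨u1, a1, b1⟩ := h1 L hL
    refine ⟨setR.boundedFormula₁ u1, ⟨k, a1⟩, fun e => ?_⟩
    rw [BoundedFormula.realize_rel₁, b1]; rfl
  | @eq E Γ k s t hs ht =>
    obtain ⟨L1, h1⟩ := hs.sound
    obtain ⟨L2, h2⟩ := ht.sound
    refine ⟨L1 ++ L2, fun L hL => ?_⟩
    obtain ⟨u1, a1, b1⟩ := h1 L (fun x hx => hL (List.mem_append_left _ hx))
    obtain ⟨u2, a2, b2⟩ := h2 L (fun x hx => hL (List.mem_append_right _ hx))
    refine ⟨Term.bdEqual u1 u2, ⟨k, a1, a2⟩, fun e => ?_⟩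
    rw [BoundedFormula.realize_bdEqual, b1, b2]
  | @imp E Γ P Q _ _ ih1 ih2 =>
    obtain ⟨L1, h1⟩ := ih1
    obtain ⟨L2, h2⟩ := ih2
    refine ⟨L1 ++ L2, fun L hL => ?_⟩
    obtain ⟨u1, a1, b1⟩ := h1 L (fun x hx => hL (List.mem_append_left _ hx))
    obtain ⟨u2, a2, b2⟩ := h2 L (fun x hx => hL (List.mem_append_right _ hx))
    refine ⟨u1.imp u2, ⟨a1, a2⟩, fun e => ?_⟩
    rw [BoundedFormula.realize_imp, b1, b2]
  | @all E Γ k P _ ih =>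
    obtain ⟨L1, h1⟩ := ih
    refine ⟨L1, fun L hL => ?_⟩
    have key : ∃ u : LNFU.BoundedFormula Empty (Cx.depth L.length Γ + 1),
        stratifiedFrom (Sum.elim Empty.elim
          (Fin.snoc (Cx.lev (fun i => (L.get i).2) Γ) k : Fin (Cx.depth L.length Γ + 1) → ℕ)) u ∧
        ∀ e : E × M, u.Realize (default : Empty → M)
          (Fin.snoc (Cx.vec (fun i => (L.get i).1) Γ e.1) e.2 :
            Fin (Cx.depth L.length Γ + 1) → M) ↔ P e.1 e.2 := h1 L hL
    obtain ⟨u, a, b⟩ := key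
    refine ⟨BoundedFormula.all u, ⟨k, ?_⟩, fun e => forall_congr' fun x => b (e, x)⟩
    have : (Sum.elim (fun x => slev L Γ (Sum.inl x))
        (Fin.snoc (fun i => slev L Γ (Sum.inr i)) k : Fin (Cx.depth L.length Γ + 1) → ℕ)) =
        (Sum.elim Empty.elim (Fin.snoc (Cx.lev (fun i => (L.get i).2) Γ) k :
          Fin (Cx.depth L.length Γ + 1) → ℕ)) := by
      funext x
      rcases x with x | x
      · exact x.elim
      · rfl
    rw [this]
    exact a

/-- Stratified comprehension. -/
theorem comp_of_model (hM : M ⊨ NFUmAC) {k : ℕ} {P : M → Prop}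
    (h : SF (Cx.nil.cons k) (fun e => P e.2)) : ∃ y : M, sset y ∧ ∀ x, smem x y ↔ P x := by
  obtain ⟨L, hL⟩ := h.sound
  have key : ∃ φ : LNFU.BoundedFormula Empty (L.length + 1), IsStratified φ ∧
      ∀ x : M, φ.Realize (default : Empty → M)
        (Fin.snoc (fun i => (L.get i).1) x : Fin (L.length + 1) → M) ↔ P x := by
    obtain ⟨φ, hs, hφ⟩ := hL L (fun _ h => h)
    exact ⟨φ, ⟨_, hs⟩, fun x => hφ ((), x)⟩
  obtain ⟨φ, hs, hφ⟩ := key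
  have hax : M ⊨ comprehensionAx L.length φ :=
    hM.realize_of_mem _ (Or.inr ⟨_, φ, hs, rfl⟩)
  have := (BoundedFormula.realize_alls.1 hax) (fun i => (L.get i).1)
  rw [BoundedFormula.realize_ex] at this
  obtain ⟨y, hy⟩ := this
  rw [BoundedFormula.realize_inf, BoundedFormula.realize_rel₁, BoundedFormula.realize_all] at hy
  refine ⟨y, ?_, fun x => ?_⟩
  · have := hy.1
    simp only [Term.realize_var, Sum.elim_inr] at this
    have e : (Fin.snoc (fun i => (L.get i).1) y : Fin (L.length + 1) → M) ⟨L.length, by omega⟩ = y :=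
      Fin.snoc_last (α := fun _ => M) _ _
    rw [e] at this
    exact this
  · have := hy.2 x
    rw [BoundedFormula.realize_iff, BoundedFormula.realize_rel₂,
      BoundedFormula.realize_liftAt_one (by omega)] at this
    have e1 : (Fin.snoc (Fin.snoc (fun i => (L.get i).1) y : Fin (L.length + 1) → M) x :
        Fin (L.length + 1 + 1) → M) ⟨L.length, by omega⟩ = y := by
      have : (⟨L.length, by omega⟩ : Fin (L.length + 1 + 1)) = Fin.castSucc (Fin.last _) := rfl
      rw [this, Fin.snoc_castSucc, Fin.snoc_last]
    have e2 : (Fin.snoc (Fin.snoc (fun i => (L.get i).1) y : Fin (L.length + 1) → M) x :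
        Fin (L.length + 1 + 1) → M) ⟨L.length + 1, by omega⟩ = x :=
      Fin.snoc_last (α := fun _ => M) _ _
    simp only [Term.realize_var, Sum.elim_inr, e1, e2] at this
    have h3 := hφ x
    refine this.trans (Iff.trans (iff_of_eq ?_) h3)
    congr 1
    funext i
    simp only [Function.comp]
    refine Fin.lastCases ?_ (fun i => ?_) i
    · rw [if_neg (by simp), Fin.snoc_last]
      exact Fin.snoc_last (α := fun _ => M) _ _
    · rw [if_pos (by simp), Fin.snoc_castSucc, Fin.snoc_castSucc, Fin.snoc_castSucc]

theorem ext_of_model (hM : M ⊨ NFUmAC) {x y : M} (hx : sset x) (hy : sset y)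
    (h : ∀ z, smem z x ↔ smem z y) : x = y := by
  have hax : M ⊨ weakExtAx := hM.realize_of_mem _ (Or.inl (Or.inl rfl))
  have := hax x y
  simp only [BoundedFormula.realize_imp, BoundedFormula.realize_inf, BoundedFormula.realize_rel₁,
    BoundedFormula.realize_iff, BoundedFormula.realize_bdEqual, BoundedFormula.realize_all,
    BoundedFormula.realize_rel₂] at this
  exact (this ⟨hx, hy⟩).2 h

theorem pair_of_model (hM : M ⊨ NFUmAC) {x y w z : M} (h : spair x y = spair w z) :
    x = w ∧ y = z := by
  have hax : M ⊨ pairingAx := hM.realize_of_mem _ (Or.inl (Or.inr rfl))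
  have := hax x y w z
  simp only [BoundedFormula.realize_imp, BoundedFormula.realize_inf,
    BoundedFormula.realize_bdEqual, Term.realize_functions_apply₂] at this
  exact this h

end Sound

/-- The semantic content of being a model of `NFUmAC`. -/
class Good (M : Type) [LNFU.Structure M] : Prop where
  comp : ∀ {k : ℕ} {P : M → Prop}, SF (Cx.nil.cons k) (fun e => P e.2) →
    ∃ y : M, sset y ∧ ∀ x, smem x y ↔ P x
  ext : ∀ {x y : M}, sset x → sset y → (∀ z, smem z x ↔ smem z y) → x = y
  pair : ∀ {x y w z : M}, spair x y = spair w z → x = w ∧ y = z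
  ne : Nonempty M

section Closure
variable {M : Type} [LNFU.Structure M]

theorem SF.not {E : Type} {Γ : Cx M E} {P : E → Prop} (h : SF Γ P) : SF Γ (fun e => ¬ P e) :=
  SF.imp h SF.fls

theorem SF.congr {E : Type} {Γ : Cx M E} {P Q : E → Prop} (h : SF Γ P) (hPQ : ∀ e, P e ↔ Q e) :
    SF Γ Q := by
  have : P = Q := funext fun e => propext (hPQ e)
  rwa [← this]

theorem SF.tru {E : Type} {Γ : Cx M E} : SF Γ (fun _ => True) :=
  (SF.not SF.fls).congr fun _ => by simp

theorem SF.and {E : Type} {Γ : Cx M E} {P Q : E → Prop} (h1 : SF Γ P) (h2 : SF Γ Q) :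
    SF Γ (fun e => P e ∧ Q e) :=
  (SF.not (SF.imp h1 (SF.not h2))).congr fun e => by tauto

theorem SF.or {E : Type} {Γ : Cx M E} {P Q : E → Prop} (h1 : SF Γ P) (h2 : SF Γ Q) :
    SF Γ (fun e => P e ∨ Q e) :=
  (SF.imp (SF.not h1) h2).congr fun e => by tauto

theorem SF.iff {E : Type} {Γ : Cx M E} {P Q : E → Prop} (h1 : SF Γ P) (h2 : SF Γ Q) :
    SF Γ (fun e => P e ↔ Q e) :=
  (SF.and (SF.imp h1 h2) (SF.imp h2 h1)).congr fun e => by tauto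

theorem SF.ex {E : Type} {Γ : Cx M E} {k : ℕ} {P : E → M → Prop}
    (h : SF (Γ.cons k) (fun e => P e.1 e.2)) : SF Γ (fun e => ∃ x, P e x) := by
  have h1 : SF Γ (fun e => ∀ x, ¬ P e x) := SF.all (k := k) (SF.not h)
  exact (SF.not h1).congr fun e => by simp

theorem SF.ne {E : Type} {Γ : Cx M E} {k : ℕ} {s t : E → M} (hs : TT Γ s k) (ht : TT Γ t k) :
    SF Γ (fun e => s e ≠ t e) := SF.not (SF.eq hs ht)

theorem TT.l1 {E : Type} {Γ : Cx M E} {j1 k : ℕ} {t : E → M} (h : TT Γ t k) :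
    TT (Γ.cons j1) (fun e => t e.1) k :=
  TT.lift (h)

theorem TT.v1 {E : Type} {Γ : Cx M E} {j1 k : ℕ} :
    TT ((Γ.cons k).cons j1) (fun e => e.1.2) k :=
  TT.lift TT.var

theorem TT.l2 {E : Type} {Γ : Cx M E} {j1 j2 k : ℕ} {t : E → M} (h : TT Γ t k) :
    TT ((Γ.cons j1).cons j2) (fun e => t e.1.1) k :=
  TT.lift (TT.l1 h)

theorem TT.v2 {E : Type} {Γ : Cx M E} {j1 j2 k : ℕ} :
    TT (((Γ.cons k).cons j1).cons j2) (fun e => e.1.1.2) k :=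
  TT.lift TT.v1

theorem TT.l3 {E : Type} {Γ : Cx M E} {j1 j2 j3 k : ℕ} {t : E → M} (h : TT Γ t k) :
    TT (((Γ.cons j1).cons j2).cons j3) (fun e => t e.1.1.1) k :=
  TT.lift (TT.l2 h)

theorem TT.v3 {E : Type} {Γ : Cx M E} {j1 j2 j3 k : ℕ} :
    TT ((((Γ.cons k).cons j1).cons j2).cons j3) (fun e => e.1.1.1.2) k :=
  TT.lift TT.v2

theorem TT.l4 {E : Type} {Γ : Cx M E} {j1 j2 j3 j4 k : ℕ} {t : E → M} (h : TT Γ t k) :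
    TT ((((Γ.cons j1).cons j2).cons j3).cons j4) (fun e => t e.1.1.1.1) k :=
  TT.lift (TT.l3 h)

theorem TT.v4 {E : Type} {Γ : Cx M E} {j1 j2 j3 j4 k : ℕ} :
    TT (((((Γ.cons k).cons j1).cons j2).cons j3).cons j4) (fun e => e.1.1.1.1.2) k :=
  TT.lift TT.v3

theorem TT.l5 {E : Type} {Γ : Cx M E} {j1 j2 j3 j4 j5 k : ℕ} {t : E → M} (h : TT Γ t k) :
    TT (((((Γ.cons j1).cons j2).cons j3).cons j4).cons j5) (fun e => t e.1.1.1.1.1) k :=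
  TT.lift (TT.l4 h)

theorem TT.v5 {E : Type} {Γ : Cx M E} {j1 j2 j3 j4 j5 k : ℕ} :
    TT ((((((Γ.cons k).cons j1).cons j2).cons j3).cons j4).cons j5) (fun e => e.1.1.1.1.1.2) k :=
  TT.lift TT.v4

theorem TT.l6 {E : Type} {Γ : Cx M E} {j1 j2 j3 j4 j5 j6 k : ℕ} {t : E → M} (h : TT Γ t k) :
    TT ((((((Γ.cons j1).cons j2).cons j3).cons j4).cons j5).cons j6) (fun e => t e.1.1.1.1.1.1) k :=
  TT.lift (TT.l5 h)

theorem TT.v6 {E : Type} {Γ : Cx M E} {j1 j2 j3 j4 j5 j6 k : ℕ} :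
    TT (((((((Γ.cons k).cons j1).cons j2).cons j3).cons j4).cons j5).cons j6) (fun e => e.1.1.1.1.1.1.2) k :=
  TT.lift TT.v5

theorem TT.l7 {E : Type} {Γ : Cx M E} {j1 j2 j3 j4 j5 j6 j7 k : ℕ} {t : E → M} (h : TT Γ t k) :
    TT (((((((Γ.cons j1).cons j2).cons j3).cons j4).cons j5).cons j6).cons j7) (fun e => t e.1.1.1.1.1.1.1) k :=
  TT.lift (TT.l6 h)

theorem TT.v7 {E : Type} {Γ : Cx M E} {j1 j2 j3 j4 j5 j6 j7 k : ℕ} :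
    TT ((((((((Γ.cons k).cons j1).cons j2).cons j3).cons j4).cons j5).cons j6).cons j7) (fun e => e.1.1.1.1.1.1.1.2) k :=
  TT.lift TT.v6

theorem TT.l8 {E : Type} {Γ : Cx M E} {j1 j2 j3 j4 j5 j6 j7 j8 k : ℕ} {t : E → M} (h : TT Γ t k) :
    TT ((((((((Γ.cons j1).cons j2).cons j3).cons j4).cons j5).cons j6).cons j7).cons j8) (fun e => t e.1.1.1.1.1.1.1.1) k :=
  TT.lift (TT.l7 h)

theorem TT.v8 {E : Type} {Γ : Cx M E} {j1 j2 j3 j4 j5 j6 j7 j8 k : ℕ} :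
    TT (((((((((Γ.cons k).cons j1).cons j2).cons j3).cons j4).cons j5).cons j6).cons j7).cons j8) (fun e => e.1.1.1.1.1.1.1.1.2) k :=
  TT.lift TT.v7

theorem TT.l9 {E : Type} {Γ : Cx M E} {j1 j2 j3 j4 j5 j6 j7 j8 j9 k : ℕ} {t : E → M} (h : TT Γ t k) :
    TT (((((((((Γ.cons j1).cons j2).cons j3).cons j4).cons j5).cons j6).cons j7).cons j8).cons j9) (fun e => t e.1.1.1.1.1.1.1.1.1) k :=
  TT.lift (TT.l8 h)

theorem TT.v9 {E : Type} {Γ : Cx M E} {j1 j2 j3 j4 j5 j6 j7 j8 j9 k : ℕ} :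
    TT ((((((((((Γ.cons k).cons j1).cons j2).cons j3).cons j4).cons j5).cons j6).cons j7).cons j8).cons j9) (fun e => e.1.1.1.1.1.1.1.1.1.2) k :=
  TT.lift TT.v8

theorem TT.l10 {E : Type} {Γ : Cx M E} {j1 j2 j3 j4 j5 j6 j7 j8 j9 j10 k : ℕ} {t : E → M} (h : TT Γ t k) :
    TT ((((((((((Γ.cons j1).cons j2).cons j3).cons j4).cons j5).cons j6).cons j7).cons j8).cons j9).cons j10) (fun e => t e.1.1.1.1.1.1.1.1.1.1) k :=
  TT.lift (TT.l9 h)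

theorem TT.v10 {E : Type} {Γ : Cx M E} {j1 j2 j3 j4 j5 j6 j7 j8 j9 j10 k : ℕ} :
    TT (((((((((((Γ.cons k).cons j1).cons j2).cons j3).cons j4).cons j5).cons j6).cons j7).cons j8).cons j9).cons j10) (fun e => e.1.1.1.1.1.1.1.1.1.1.2) k :=
  TT.lift TT.v9

theorem TT.l11 {E : Type} {Γ : Cx M E} {j1 j2 j3 j4 j5 j6 j7 j8 j9 j10 j11 k : ℕ} {t : E → M} (h : TT Γ t k) :
    TT (((((((((((Γ.cons j1).cons j2).cons j3).cons j4).cons j5).cons j6).cons j7).cons j8).cons j9).cons j10).cons j11) (fun e => t e.1.1.1.1.1.1.1.1.1.1.1) k :=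
  TT.lift (TT.l10 h)

theorem TT.v11 {E : Type} {Γ : Cx M E} {j1 j2 j3 j4 j5 j6 j7 j8 j9 j10 j11 k : ℕ} :
    TT ((((((((((((Γ.cons k).cons j1).cons j2).cons j3).cons j4).cons j5).cons j6).cons j7).cons j8).cons j9).cons j10).cons j11) (fun e => e.1.1.1.1.1.1.1.1.1.1.1.2) k :=
  TT.lift TT.v10

theorem TT.l12 {E : Type} {Γ : Cx M E} {j1 j2 j3 j4 j5 j6 j7 j8 j9 j10 j11 j12 k : ℕ} {t : E → M} (h : TT Γ t k) :
    TT ((((((((((((Γ.cons j1).cons j2).cons j3).cons j4).cons j5).cons j6).cons j7).cons j8).cons j9).cons j10).cons j11).cons j12) (fun e => t e.1.1.1.1.1.1.1.1.1.1.1.1) k :=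
  TT.lift (TT.l11 h)

theorem TT.v12 {E : Type} {Γ : Cx M E} {j1 j2 j3 j4 j5 j6 j7 j8 j9 j10 j11 j12 k : ℕ} :
    TT (((((((((((((Γ.cons k).cons j1).cons j2).cons j3).cons j4).cons j5).cons j6).cons j7).cons j8).cons j9).cons j10).cons j11).cons j12) (fun e => e.1.1.1.1.1.1.1.1.1.1.1.1.2) k :=
  TT.lift TT.v11

end Closure

theorem TT.l0 {M : Type} [LNFU.Structure M] {E : Type} {Γ : Cx M E} {t : E → M} {k : ℕ}
    (h : TT Γ t k) : TT Γ t k := h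

theorem strat {M : Type} [LNFU.Structure M] {E : Type} {Γ : Cx M E} {P : E → Prop}
    (h : SF Γ P := by
      (repeat' first
        | (with_reducible apply TT.l0; assumption)
        | with_reducible apply TT.var
        | with_reducible apply TT.v1
        | with_reducible apply TT.v2
        | with_reducible apply TT.v3
        | with_reducible apply TT.v4
        | with_reducible apply TT.v5
        | with_reducible apply TT.v6
        | with_reducible apply TT.v7
        | with_reducible apply TT.v8
        | with_reducible apply TT.v9
        | with_reducible apply TT.v10
        | with_reducible apply TT.v11
        | with_reducible apply TT.v12
        | with_reducible apply TT.const
        | (with_reducible apply TT.l1; assumption)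
        | (with_reducible apply TT.l2; assumption)
        | (with_reducible apply TT.l3; assumption)
        | (with_reducible apply TT.l4; assumption)
        | (with_reducible apply TT.l5; assumption)
        | (with_reducible apply TT.l6; assumption)
        | (with_reducible apply TT.l7; assumption)
        | (with_reducible apply TT.l8; assumption)
        | (with_reducible apply TT.l9; assumption)
        | (with_reducible apply TT.l10; assumption)
        | (with_reducible apply TT.l11; assumption)
        | (with_reducible apply TT.l12; assumption)
        | with_reducible apply TT.pair
        | with_reducible apply SF_isSingletonOf
        | with_reducible apply SF_isEmptySet
        | with_reducible apply SF_isFunc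
        | with_reducible apply SF_inField
        | with_reducible apply SF_isZeroCard
        | with_reducible apply SF_isSuccOf
        | with_reducible apply SF_isIotaImageOf
        | with_reducible apply SF_isInjFunc
        | with_reducible apply SF_inSeg
        | with_reducible apply SF_isIsoRel
        | with_reducible apply SF_isBFEXT
        | with_reducible apply SF_isInductiveSet
        | with_reducible apply SF_isNat
        | with_reducible apply SF_isBijFunc
        | with_reducible apply SF_isSegOf
        | with_reducible apply SF_relIso
        | with_reducible apply SF_equipollent
        | with_reducible apply SF_inOmega
        | with_reducible apply SF_isTopOf
        | with_reducible apply SF_isTypeOf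
        | with_reducible apply SF_isCardOf
        | with_reducible apply SF_inBF
        | with_reducible apply SF_erel
        | with_reducible apply SF_isTOf
        | with_reducible apply SF_isFieldSetOf
        | with_reducible apply SF_Cl
        | with_reducible apply SF_Bis
        | with_reducible apply SF_flag
        | with_reducible apply SF_le
        | with_reducible apply SF_FinSet
        | with_reducible apply SF_isPowerSetOf
        | with_reducible apply SF_isProdOf
        | with_reducible apply SF_isF
        | with_reducible apply SF_bd
        | with_reducible apply SF_Dd
        | with_reducible apply SF_lexx
        | with_reducible apply SF_code
        | with_reducible apply SF.mem
        | with_reducible apply SF.set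
        | with_reducible apply SF.and
        | with_reducible apply SF.or
        | with_reducible apply SF.not
        | with_reducible apply SF.imp
        | with_reducible apply SF.iff
        | with_reducible apply SF.all
        | with_reducible apply SF.ex
        | with_reducible apply SF.eq
        | with_reducible apply SF.ne
        | with_reducible exact SF.fls
        | with_reducible exact SF.tru)
      all_goals exact (0 : ℕ)) : SF Γ P := h

theorem mk {M : Type} [LNFU.Structure M] [Good M] (P : M → Prop)
    (h : ∃ k, SF (Cx.nil.cons k) (fun e => P e.2) := by
      apply Exists.intro
      (repeat' first
        | (with_reducible apply TT.l0; assumption)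
        | with_reducible apply TT.var
        | with_reducible apply TT.v1
        | with_reducible apply TT.v2
        | with_reducible apply TT.v3
        | with_reducible apply TT.v4
        | with_reducible apply TT.v5
        | with_reducible apply TT.v6
        | with_reducible apply TT.v7
        | with_reducible apply TT.v8
        | with_reducible apply TT.v9
        | with_reducible apply TT.v10
        | with_reducible apply TT.v11
        | with_reducible apply TT.v12
        | with_reducible apply TT.const
        | (with_reducible apply TT.l1; assumption)
        | (with_reducible apply TT.l2; assumption)
        | (with_reducible apply TT.l3; assumption)
        | (with_reducible apply TT.l4; assumption)
        | (with_reducible apply TT.l5; assumption)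
        | (with_reducible apply TT.l6; assumption)
        | (with_reducible apply TT.l7; assumption)
        | (with_reducible apply TT.l8; assumption)
        | (with_reducible apply TT.l9; assumption)
        | (with_reducible apply TT.l10; assumption)
        | (with_reducible apply TT.l11; assumption)
        | (with_reducible apply TT.l12; assumption)
        | with_reducible apply TT.pair
        | with_reducible apply SF_isSingletonOf
        | with_reducible apply SF_isEmptySet
        | with_reducible apply SF_isFunc
        | with_reducible apply SF_inField
        | with_reducible apply SF_isZeroCard
        | with_reducible apply SF_isSuccOf
        | with_reducible apply SF_isIotaImageOf
        | with_reducible apply SF_isInjFunc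
        | with_reducible apply SF_inSeg
        | with_reducible apply SF_isIsoRel
        | with_reducible apply SF_isBFEXT
        | with_reducible apply SF_isInductiveSet
        | with_reducible apply SF_isNat
        | with_reducible apply SF_isBijFunc
        | with_reducible apply SF_isSegOf
        | with_reducible apply SF_relIso
        | with_reducible apply SF_equipollent
        | with_reducible apply SF_inOmega
        | with_reducible apply SF_isTopOf
        | with_reducible apply SF_isTypeOf
        | with_reducible apply SF_isCardOf
        | with_reducible apply SF_inBF
        | with_reducible apply SF_erel
        | with_reducible apply SF_isTOf
        | with_reducible apply SF_isFieldSetOf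
        | with_reducible apply SF_Cl
        | with_reducible apply SF_Bis
        | with_reducible apply SF_flag
        | with_reducible apply SF_le
        | with_reducible apply SF_FinSet
        | with_reducible apply SF_isPowerSetOf
        | with_reducible apply SF_isProdOf
        | with_reducible apply SF_isF
        | with_reducible apply SF_bd
        | with_reducible apply SF_Dd
        | with_reducible apply SF_lexx
        | with_reducible apply SF_code
        | with_reducible apply SF.mem
        | with_reducible apply SF.set
        | with_reducible apply SF.and
        | with_reducible apply SF.or
        | with_reducible apply SF.not
        | with_reducible apply SF.imp
        | with_reducible apply SF.iff
        | with_reducible apply SF.all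
        | with_reducible apply SF.ex
        | with_reducible apply SF.eq
        | with_reducible apply SF.ne
        | with_reducible exact SF.fls
        | with_reducible exact SF.tru)
      all_goals exact (0 : ℕ)) : ∃ y : M, sset y ∧ ∀ x, smem x y ↔ P x :=
  h.elim fun _ h => Good.comp h


section Basic
variable {M : Type} [LNFU.Structure M] {E : Type} {Γ : Cx M E} {k : ℕ}

theorem SF_isSingletonOf {s x : E → M} (h1 : TT Γ x k) (h2 : TT Γ s (k + 1)) :
    SF Γ (fun e => isSingletonOf (s e) (x e)) := by
  unfold isSingletonOf; exact strat

theorem SF_isEmptySet {s : E → M} (h2 : TT Γ s (k + 1)) :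
    SF Γ (fun e => isEmptySet (s e)) := by
  unfold isEmptySet; exact strat

theorem SF_isFunc {f X Y : E → M} (h1 : TT Γ f (k + 1)) (h2 : TT Γ X (k + 1))
    (h3 : TT Γ Y (k + 1)) : SF Γ (fun e => isFunc (f e) (X e) (Y e)) := by
  unfold isFunc; exact strat

theorem SF_inField {x R : E → M} (h1 : TT Γ x k) (h2 : TT Γ R (k + 1)) :
    SF Γ (fun e => inField (x e) (R e)) := by
  unfold inField; exact strat

theorem SF_isZeroCard {z : E → M} (h1 : TT Γ z (k + 2)) :
    SF Γ (fun e => isZeroCard (z e)) := by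
  unfold isZeroCard; exact strat

theorem SF_isSuccOf {s x : E → M} (h1 : TT Γ s (k + 2)) (h2 : TT Γ x (k + 2)) :
    SF Γ (fun e => isSuccOf (s e) (x e)) := by
  unfold isSuccOf; exact strat


theorem SF_isIotaImageOf {Y X : E → M} (h1 : TT Γ X (k + 1)) (h2 : TT Γ Y (k + 2)) :
    SF Γ (fun e => isIotaImageOf (Y e) (X e)) := by
  unfold isIotaImageOf; exact strat

theorem SF_isInjFunc {f X Y : E → M} (h1 : TT Γ f (k + 1)) (h2 : TT Γ X (k + 1))
    (h3 : TT Γ Y (k + 1)) : SF Γ (fun e => isInjFunc (f e) (X e) (Y e)) := by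
  unfold isInjFunc; exact strat

theorem SF_inSeg {x R a : E → M} (h1 : TT Γ x k) (h2 : TT Γ R (k + 1)) (h3 : TT Γ a k) :
    SF Γ (fun e => inSeg (x e) (R e) (a e)) := by
  unfold inSeg; exact strat

theorem SF_isIsoRel {f R S : E → M} (h1 : TT Γ f (k + 1)) (h2 : TT Γ R (k + 1))
    (h3 : TT Γ S (k + 1)) : SF Γ (fun e => isIsoRel (f e) (R e) (S e)) := by
  unfold isIsoRel; exact strat

theorem SF_isBFEXT {R : E → M} (h1 : TT Γ R (k + 1)) : SF Γ (fun e => isBFEXT (R e)) := by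
  unfold isBFEXT isRel; exact strat

theorem SF_isInductiveSet {R : E → M} (h1 : TT Γ R (k + 3)) :
    SF Γ (fun e => isInductiveSet (R e)) := by
  unfold isInductiveSet; exact strat


theorem SF_isNat {n : E → M} (h1 : TT Γ n (k + 2)) : SF Γ (fun e => isNat (n e)) := by
  unfold isNat; exact strat

theorem SF_isBijFunc {f X Y : E → M} (h1 : TT Γ f (k + 1)) (h2 : TT Γ X (k + 1))
    (h3 : TT Γ Y (k + 1)) : SF Γ (fun e => isBijFunc (f e) (X e) (Y e)) := by
  unfold isBijFunc; exact strat

theorem SF_isSegOf {s R a : E → M} (h1 : TT Γ s (k + 1)) (h2 : TT Γ R (k + 1)) (h3 : TT Γ a k) :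
    SF Γ (fun e => isSegOf (s e) (R e) (a e)) := by
  unfold isSegOf; exact strat

theorem SF_relIso {R S : E → M} (h2 : TT Γ R (k + 1))
    (h3 : TT Γ S (k + 1)) : SF Γ (fun e => relIso (R e) (S e)) := by
  unfold relIso; exact strat


theorem SF_equipollent {X Y : E → M} (h2 : TT Γ X (k + 1))
    (h3 : TT Γ Y (k + 1)) : SF Γ (fun e => equipollent (X e) (Y e)) := by
  unfold equipollent; exact strat

theorem SF_inOmega {R : E → M} (h2 : TT Γ R (k + 1)) : SF Γ (fun e => inOmega (R e)) := by
  unfold inOmega; exact strat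

theorem SF_isTopOf {a R : E → M} (h1 : TT Γ a k) (h2 : TT Γ R (k + 1)) :
    SF Γ (fun e => isTopOf (a e) (R e)) := by
  unfold isTopOf; exact strat

theorem SF_isTypeOf {t R : E → M} (h1 : TT Γ t (k + 2)) (h2 : TT Γ R (k + 1)) :
    SF Γ (fun e => isTypeOf (t e) (R e)) := by
  unfold isTypeOf; exact strat


theorem SF_isCardOf {c X : E → M} (h1 : TT Γ c (k + 2)) (h2 : TT Γ X (k + 1)) :
    SF Γ (fun e => isCardOf (c e) (X e)) := by
  unfold isCardOf; exact strat

theorem SF_inBF {a : E → M} (h1 : TT Γ a (k + 2)) : SF Γ (fun e => inBF (a e)) := by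
  unfold inBF; exact strat

theorem SF_erel {a b : E → M} (h1 : TT Γ a (k + 2)) (h2 : TT Γ b (k + 2)) :
    SF Γ (fun e => erel (a e) (b e)) := by
  unfold erel; exact strat


theorem SF_isTOf {t c : E → M} (h1 : TT Γ t (k + 3)) (h2 : TT Γ c (k + 2)) :
    SF Γ (fun e => isTOf (t e) (c e)) := by
  unfold isTOf; exact strat

end Basic


section Basic2
variable {M : Type} [LNFU.Structure M] {E : Type} {Γ : Cx M E} {k : ℕ}

theorem SF_isFieldSetOf {D R : E → M} (h1 : TT Γ D (k + 1)) (h2 : TT Γ R (k + 1)) :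
    SF Γ (fun e => isFieldSetOf (D e) (R e)) := by
  unfold isFieldSetOf; exact strat

end Basic2

section Kit
variable {M : Type} [LNFU.Structure M] [Good M]

theorem pair_inj {x y w z : M} : spair x y = spair w z ↔ x = w ∧ y = z :=
  ⟨Good.pair, fun h => by rw [h.1, h.2]⟩

theorem mkRel (P : M → M → Prop)
    (h : ∃ y : M, sset y ∧ ∀ x, smem x y ↔ ∃ a b, x = spair a b ∧ P a b) :
    ∃ f : M, sset f ∧ (∀ p, smem p f → ∃ a b, p = spair a b ∧ P a b) ∧
      ∀ a b, smem (spair a b) f ↔ P a b := by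
  obtain ⟨y, hy, h⟩ := h
  refine ⟨y, hy, fun p hp => (h p).1 hp, fun a b => ?_⟩
  rw [h]
  constructor
  · rintro ⟨a', b', e, hP⟩
    obtain ⟨rfl, rfl⟩ := pair_inj.1 e
    exact hP
  · intro hP
    exact ⟨a, b, rfl, hP⟩

theorem inj_of {X Y : M} (P : M → M → Prop)
    (h : ∃ y : M, sset y ∧ ∀ x, smem x y ↔ ∃ a b, x = spair a b ∧ smem a X ∧ smem b Y ∧ P a b)
    (tot : ∀ a, smem a X → ∃ b, smem b Y ∧ P a b)
    (fn : ∀ a b b', smem a X → smem b Y → smem b' Y → P a b → P a b' → b = b')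
    (inj : ∀ a a' b, smem a X → smem a' X → smem b Y → P a b → P a' b → a = a') :
    ∃ f, isInjFunc f X Y ∧ ∀ a b, smem (spair a b) f ↔ smem a X ∧ smem b Y ∧ P a b := by
  obtain ⟨f, hf, h1, h2⟩ := mkRel (fun a b => smem a X ∧ smem b Y ∧ P a b) h
  refine ⟨f, ⟨⟨hf, ?_, ?_, ?_⟩, ?_⟩, h2⟩
  · intro p hp
    obtain ⟨a, b, e, ha, hb, _⟩ := h1 p hp
    exact ⟨a, b, e, ha, hb⟩
  · intro a ha
    obtain ⟨b, hb, hP⟩ := tot a ha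
    exact ⟨b, (h2 a b).2 ⟨ha, hb, hP⟩⟩
  · intro a b b' h3 h4
    obtain ⟨ha, hb, hP⟩ := (h2 _ _).1 h3
    obtain ⟨_, hb', hP'⟩ := (h2 _ _).1 h4
    exact fn a b b' ha hb hb' hP hP'
  · intro a a' b h3 h4
    obtain ⟨ha, hb, hP⟩ := (h2 _ _).1 h3
    obtain ⟨ha', _, hP'⟩ := (h2 _ _).1 h4
    exact inj a a' b ha ha' hb hP hP'

theorem eqp_of {X Y : M} (P : M → M → Prop)
    (h : ∃ y : M, sset y ∧ ∀ x, smem x y ↔ ∃ a b, x = spair a b ∧ smem a X ∧ smem b Y ∧ P a b)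
    (tot : ∀ a, smem a X → ∃ b, smem b Y ∧ P a b)
    (fn : ∀ a b b', smem a X → smem b Y → smem b' Y → P a b → P a b' → b = b')
    (inj : ∀ a a' b, smem a X → smem a' X → smem b Y → P a b → P a' b → a = a')
    (sur : ∀ b, smem b Y → ∃ a, smem a X ∧ P a b) : equipollent X Y := by
  obtain ⟨f, hf, h2⟩ := inj_of P h tot fn inj
  refine ⟨f, hf, fun b hb => ?_⟩
  obtain ⟨a, ha, hP⟩ := sur b hb
  exact ⟨a, (h2 _ _).2 ⟨ha, hb, hP⟩⟩

theorem isFunc.mem {f X Y a b : M} (h : isFunc f X Y) (hab : smem (spair a b) f) :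
    smem a X ∧ smem b Y := by
  obtain ⟨a', b', e, ha, hb⟩ := h.2.1 _ hab
  obtain ⟨rfl, rfl⟩ := pair_inj.1 e
  exact ⟨ha, hb⟩

theorem eqp_of_same {X Y : M} (h : ∀ x, smem x X ↔ smem x Y) : equipollent X Y :=
  eqp_of (fun a b => a = b) (mk _) (fun a ha => ⟨a, (h a).1 ha, rfl⟩)
    (fun _ _ _ _ _ _ h h' => h.symm.trans h') (fun _ _ _ _ _ _ h h' => h.trans h'.symm)
    (fun a ha => ⟨a, (h a).2 ha, rfl⟩)

theorem eqp_refl (X : M) : equipollent X X := eqp_of_same fun _ => Iff.rfl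

theorem eqp_symm {X Y : M} (h : equipollent X Y) : equipollent Y X := by
  obtain ⟨f, hf, hs⟩ := h
  refine eqp_of (fun a b => smem (spair b a) f) (mk _) ?_ ?_ ?_ ?_
  · intro b hb
    obtain ⟨a, ha⟩ := hs b hb
    exact ⟨a, (hf.1.mem ha).1, ha⟩
  · intro a b b' _ _ _ h1 h2
    exact hf.2 _ _ _ h1 h2
  · intro a a' b _ _ _ h1 h2
    exact hf.1.2.2.2 _ _ _ h1 h2
  · intro a ha
    obtain ⟨b, hb⟩ := hf.1.2.2.1 a ha
    exact ⟨b, (hf.1.mem hb).2, hb⟩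

theorem eqp_trans {X Y Z : M} (h : equipollent X Y) (h' : equipollent Y Z) : equipollent X Z := by
  obtain ⟨f, hf, hs⟩ := h
  obtain ⟨g, hg, hs'⟩ := h'
  refine eqp_of (fun a b => ∃ c, smem (spair a c) f ∧ smem (spair c b) g) (mk _) ?_ ?_ ?_ ?_
  · intro a ha
    obtain ⟨c, hc⟩ := hf.1.2.2.1 a ha
    obtain ⟨b, hb⟩ := hg.1.2.2.1 c (hf.1.mem hc).2
    exact ⟨b, (hg.1.mem hb).2, c, hc, hb⟩
  · rintro a b b' _ _ _ ⟨c, h1, h2⟩ ⟨c', h3, h4⟩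
    obtain rfl := hf.1.2.2.2 _ _ _ h1 h3
    exact hg.1.2.2.2 _ _ _ h2 h4
  · rintro a a' b _ _ _ ⟨c, h1, h2⟩ ⟨c', h3, h4⟩
    obtain rfl := hg.2 _ _ _ h2 h4
    exact hf.2 _ _ _ h1 h3
  · intro b hb
    obtain ⟨c, hc⟩ := hs' b hb
    obtain ⟨a, ha⟩ := hs c (hg.1.mem hc).1
    exact ⟨a, (hf.1.mem ha).1, c, ha, hc⟩

theorem exists_card (X : M) : ∃ c : M, isCardOf c X := mk (fun y => equipollent y X)

theorem card_congr {c X Y : M} (h : isCardOf c X) (e : equipollent X Y) : isCardOf c Y :=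
  ⟨h.1, fun y => (h.2 y).trans ⟨fun h => eqp_trans h e, fun h => eqp_trans h (eqp_symm e)⟩⟩

theorem card_unique {c c' X : M} (h : isCardOf c X) (h' : isCardOf c' X) : c = c' :=
  Good.ext h.1 h'.1 fun y => (h.2 y).trans (h'.2 y).symm

theorem exists_iota (X : M) : ∃ Y : M, isIotaImageOf Y X :=
  mk (fun z => ∃ x, smem x X ∧ isSingletonOf z x)

theorem exists_single (x : M) : ∃ s : M, isSingletonOf s x := mk (fun z => z = x)

theorem single_inj {s x y : M} (h : isSingletonOf s x) (h' : isSingletonOf s y) : x = y :=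
  (h'.2 x).1 ((h.2 x).2 rfl)

theorem single_unique {s s' x : M} (h : isSingletonOf s x) (h' : isSingletonOf s' x) : s = s' :=
  Good.ext h.1 h'.1 fun z => (h.2 z).trans (h'.2 z).symm

theorem eqp_adj {X X' Y Y' x y : M} (hX : ∀ u, smem u X ↔ smem u X' ∧ u ≠ x) (hx : smem x X')
    (hY : ∀ u, smem u Y ↔ smem u Y' ∧ u ≠ y) (hy : smem y Y') (h : equipollent X Y) :
    equipollent X' Y' := by
  obtain ⟨f, hf, hs⟩ := h
  refine eqp_of (fun a b => smem (spair a b) f ∨ (a = x ∧ b = y)) (mk _) ?_ ?_ ?_ ?_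
  · intro a ha
    by_cases e : a = x
    · exact ⟨y, hy, Or.inr ⟨e, rfl⟩⟩
    · obtain ⟨b, hb⟩ := hf.1.2.2.1 a ((hX a).2 ⟨ha, e⟩)
      exact ⟨b, ((hY b).1 (hf.1.mem hb).2).1, Or.inl hb⟩
  · rintro a b b' _ _ _ (h1 | ⟨rfl, rfl⟩) (h2 | ⟨e, rfl⟩)
    · exact hf.1.2.2.2 _ _ _ h1 h2
    · exact absurd e ((hX _).1 (hf.1.mem h1).1).2
    · exact absurd rfl ((hX _).1 (hf.1.mem h2).1).2
    · rfl
  · rintro a a' b _ _ _ (h1 | ⟨rfl, rfl⟩) (h2 | ⟨rfl, e⟩)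
    · exact hf.2 _ _ _ h1 h2
    · exact absurd e ((hY _).1 (hf.1.mem h1).2).2
    · exact absurd rfl ((hY _).1 (hf.1.mem h2).2).2
    · rfl
  · intro b hb
    by_cases e : b = y
    · exact ⟨x, hx, Or.inr ⟨rfl, e⟩⟩
    · obtain ⟨a, ha⟩ := hs b ((hY b).2 ⟨hb, e⟩)
      exact ⟨a, ((hX a).1 (hf.1.mem ha).1).1, Or.inl ha⟩

theorem exists_remove (X x : M) : ∃ d : M, sset d ∧ ∀ u, smem u d ↔ smem u X ∧ u ≠ x :=
  mk (fun u => smem u X ∧ u ≠ x)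

theorem card_succ {t t' Y Y' w : M} (hw : smem w Y') (hY : ∀ u, smem u Y ↔ smem u Y' ∧ u ≠ w)
    (ht : isCardOf t Y) (ht' : isCardOf t' Y') : isSuccOf t' t := by
  refine ⟨ht'.1, fun y => ?_⟩
  rw [ht'.2]
  constructor
  · rintro ⟨f, hf, hs⟩
    obtain ⟨z, hz⟩ := hs w hw
    obtain ⟨d, hd, hd'⟩ := exists_remove y z
    refine ⟨z, (hf.1.mem hz).1, d, hd, hd', ?_⟩
    rw [ht.2]
    refine eqp_of (fun a b => smem (spair a b) f) (mk _) ?_ ?_ ?_ ?_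
    · intro a ha
      obtain ⟨b, hb⟩ := hf.1.2.2.1 a ((hd' a).1 ha).1
      refine ⟨b, (hY b).2 ⟨(hf.1.mem hb).2, ?_⟩, hb⟩
      rintro rfl
      exact ((hd' a).1 ha).2 (hf.2 _ _ _ hb hz)
    · intro a b b' _ _ _ h1 h2
      exact hf.1.2.2.2 _ _ _ h1 h2
    · intro a a' b _ _ _ h1 h2
      exact hf.2 _ _ _ h1 h2
    · intro b hb
      obtain ⟨a, ha⟩ := hs b ((hY b).1 hb).1
      refine ⟨a, (hd' a).2 ⟨(hf.1.mem ha).1, ?_⟩, ha⟩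
      rintro rfl
      exact ((hY b).1 hb).2 (hf.1.2.2.2 _ _ _ ha hz)
  · rintro ⟨z, hz, d, hd, hd', hdt⟩
    exact eqp_adj hd' hz hY hw ((ht.2 d).1 hdt)

theorem card_zero {t Y : M} (hY : ∀ u, ¬ smem u Y) (ht : isCardOf t Y) : isZeroCard t := by
  refine ⟨ht.1, fun y => ?_⟩
  rw [ht.2]
  constructor
  · rintro ⟨f, hf, _⟩ w hw
    obtain ⟨b, hb⟩ := hf.1.2.2.1 w hw
    exact hY b (hf.1.mem hb).2
  · intro h
    exact eqp_of_same fun x => ⟨fun hx => absurd hx (h x), fun hx => absurd hx (hY x)⟩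

theorem T_zero {t z : M} (hz : isZeroCard z) (ht : isTOf t z) : isZeroCard t := by
  obtain ⟨X, Y, hX, hY, ht⟩ := ht
  refine card_zero (fun u hu => ?_) ht
  obtain ⟨x, hx, _⟩ := (hY.2 u).1 hu
  exact (hz.2 X).1 hX x hx

theorem T_succ {n n' t' : M} (hn : isSuccOf n' n) (ht : isTOf t' n') :
    ∃ t, isTOf t n ∧ isSuccOf t' t := by
  obtain ⟨X, Y, hX, hY, ht⟩ := ht
  obtain ⟨z, hz, d, hd, hd', hdn⟩ := (hn.2 X).1 hX
  obtain ⟨Y0, hY0⟩ := exists_iota d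
  obtain ⟨t, ht0⟩ := exists_card Y0
  obtain ⟨w, hw⟩ := exists_single z
  refine ⟨t, ⟨d, Y0, hdn, hY0, ht0⟩, card_succ (w := w) ((hY.2 w).2 ⟨z, hz, hw⟩) (fun u => ?_) ht0 ht⟩
  rw [hY0.2, hY.2]
  constructor
  · rintro ⟨x, hx, hu⟩
    refine ⟨⟨x, ((hd' x).1 hx).1, hu⟩, ?_⟩
    rintro rfl
    exact ((hd' x).1 hx).2 (single_inj hu hw)
  · rintro ⟨⟨x, hx, hu⟩, hne⟩
    refine ⟨x, (hd' x).2 ⟨hx, ?_⟩, hu⟩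
    rintro rfl
    exact hne (single_unique hu hw)

theorem nat_zero {z : M} (h : isZeroCard z) : isNat z := fun _ hI => hI.2.1 z h

theorem nat_succ {n n' : M} (h : isNat n) (h' : isSuccOf n' n) : isNat n' :=
  fun I hI => hI.2.2 n n' (h I hI) h'

theorem nat_ind (P : M → Prop) (h : ∃ y : M, sset y ∧ ∀ x, smem x y ↔ isNat x ∧ P x)
    (zero : ∀ z, isZeroCard z → P z)
    (succ : ∀ a b, isNat a → P a → isSuccOf b a → P b) {n : M} (hn : isNat n) : P n := by
  obtain ⟨I, hI, h⟩ := h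
  refine ((h n).1 (hn I ⟨hI, fun z hz => (h z).2 ⟨nat_zero hz, zero z hz⟩, fun a b ha hb => ?_⟩)).2
  obtain ⟨h1, h2⟩ := (h a).1 ha
  exact (h b).2 ⟨nat_succ h1 hb, succ a b h1 h2 hb⟩

theorem T_nat {n : M} (hn : isNat n) : ∀ t, isTOf t n → isNat t := by
  refine nat_ind (fun n => ∀ t, isTOf t n → isNat t) (mk _) ?_ ?_ hn
  · intro z hz t ht
    exact nat_zero (T_zero hz ht)
  · intro a b ha ih hb t ht
    obtain ⟨t0, ht0, hs⟩ := T_succ hb ht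
    exact nat_succ (ih t0 ht0) hs

end Kit

section Ext
variable {M : Type} [LNFU.Structure M]

/-- `B` is a bisimulation between `R` and `S`. -/
def Bis (B R S : M) : Prop := ∀ u v, smem (spair u v) B →
  (∀ u', smem (spair u' u) R → ∃ v', smem (spair v' v) S ∧ smem (spair u' v') B) ∧
  (∀ v', smem (spair v' v) S → ∃ u', smem (spair u' u) R ∧ smem (spair u' v') B)

/-- The top of some member of `a` has a minimal predecessor. -/
def flag (a : M) : Prop := ∃ R x r, smem R a ∧ isTopOf r R ∧ smem (spair x r) R ∧
  ∀ z, ¬ smem (spair z x) R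

theorem SF_Bis {E : Type} {Γ : Cx M E} {k : ℕ} {B R S : E → M} (h1 : TT Γ B (k + 1))
    (h2 : TT Γ R (k + 1)) (h3 : TT Γ S (k + 1)) :
    SF Γ (fun e => Bis (B e) (R e) (S e)) := by
  unfold Bis; exact strat

theorem SF_flag {E : Type} {Γ : Cx M E} {k : ℕ} {a : E → M} (h1 : TT Γ a (k + 2)) :
    SF Γ (fun e => flag (a e)) := by
  unfold flag; exact strat

/-- A weak form of being a top. -/
def wtop (y Y : M) : Prop := inField y Y ∧ ∀ x, inField x Y → inSeg x Y y

variable [Good M]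

theorem bis_fun {B R S u v v' : M} (hS : isBFEXT S) (hB : Bis B R S)
    (h1 : smem (spair u v) B) (h2 : smem (spair u v') B) (hv : inField v S) (hv' : inField v' S) :
    v = v' := by
  by_contra hne
  obtain ⟨D, hD, hDm⟩ := mk (fun v => inField v S ∧ ∃ u v', inField v' S ∧
    smem (spair u v) B ∧ smem (spair u v') B ∧ v ≠ v')
  obtain ⟨w, hw, hmin⟩ := hS.2.1 D hD ⟨v, (hDm v).2 ⟨hv, u, v', hv', h1, h2, hne⟩⟩
    fun b hb => ((hDm b).1 hb).1
  obtain ⟨hwS, x, w', hw'S, h3, h4, hne'⟩ := (hDm w).1 hw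
  refine hne' (hS.2.2 w w' hwS hw'S fun c => ⟨fun hc => ?_, fun hc => ?_⟩)
  · obtain ⟨u', hu', hb⟩ := (hB _ _ h3).2 c hc
    obtain ⟨c', hc', hb'⟩ := (hB _ _ h4).1 u' hu'
    by_cases e : c = c'
    · rwa [e]
    · exact absurd hc (hmin c ((hDm c).2 ⟨⟨w, Or.inl hc⟩, u', c', ⟨w', Or.inl hc'⟩, hb, hb', e⟩))
  · obtain ⟨u', hu', hb⟩ := (hB _ _ h4).2 c hc
    obtain ⟨c', hc', hb'⟩ := (hB _ _ h3).1 u' hu'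
    by_cases e : c' = c
    · rwa [← e]
    · exact absurd hc' (hmin c' ((hDm c').2 ⟨⟨w, Or.inl hc'⟩, u', c, ⟨w', Or.inl hc⟩, hb', hb, e⟩))

theorem bis_conv {B R S : M} (hB : Bis B R S) :
    ∃ B', (∀ u v, smem (spair v u) B' ↔ smem (spair u v) B) ∧ Bis B' S R := by
  obtain ⟨B', _, _, h⟩ := mkRel (fun v u => smem (spair u v) B) (mk _)
  refine ⟨B', fun u v => h v u, fun v u hvu => ?_⟩
  rw [h] at hvu
  obtain ⟨h1, h2⟩ := hB _ _ hvu
  exact ⟨fun v' hv' => by simpa only [h] using h2 v' hv',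
    fun u' hu' => by simpa only [h] using h1 u' hu'⟩

theorem bis_inj {B R S u u' v : M} (hR : isBFEXT R) (hB : Bis B R S)
    (h1 : smem (spair u v) B) (h2 : smem (spair u' v) B) (hv : inField u R) (hv' : inField u' R) :
    u = u' := by
  obtain ⟨B', h, hB'⟩ := bis_conv hB
  exact bis_fun hR hB' ((h _ _).2 h1) ((h _ _).2 h2) hv hv'

theorem top_wtop {r R : M} (h : isTopOf r R) : wtop r R := by
  refine ⟨h.1, fun x hx => ?_⟩
  obtain ⟨y, hy | hy⟩ := hx
  · obtain ⟨_, a, b, e, ha, hb⟩ := (h.2.2 _).1 hy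
    obtain ⟨rfl, rfl⟩ := pair_inj.1 e
    exact ha
  · obtain ⟨_, a, b, e, ha, hb⟩ := (h.2.2 _).1 hy
    obtain ⟨rfl, rfl⟩ := pair_inj.1 e
    exact hb

theorem seg_ind {a R x : M} (P : M → Prop) (h : ∃ y : M, sset y ∧ ∀ x, smem x y ↔ inField x R ∧ P x)
    (ha : inField a R) (h0 : P a) (h1 : ∀ b c, inField b R → P b → smem (spair c b) R → P c)
    (hx : inSeg x R a) : P x := by
  obtain ⟨B, hB, h⟩ := h
  refine ((h x).1 (hx B hB (fun b hb => ((h b).1 hb).1) ((h a).2 ⟨ha, h0⟩) fun b c hb hc => ?_)).2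
  obtain ⟨h2, h3⟩ := (h b).1 hb
  exact (h c).2 ⟨⟨b, Or.inl hc⟩, h1 b c h2 h3 hc⟩

theorem topiso {B R S r s : M} (hR : isBFEXT R) (hS : isBFEXT S) (hr : isTopOf r R)
    (hs : isTopOf s S) (hB : Bis B R S) (hrs : smem (spair r s) B) : relIso R S := by
  obtain ⟨f, hf, hf1, hf2⟩ := mkRel (fun u v => inField u R ∧ inField v S ∧ smem (spair u v) B) (mk _)
  refine ⟨f, hf, ?_, ?_, ?_, ?_, ?_, ?_⟩
  · intro p hp
    obtain ⟨a, b, e, ha, hb, _⟩ := hf1 p hp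
    exact ⟨a, b, e, ha, hb⟩
  · intro x hx
    have := seg_ind (R := R) (a := r) (x := x) (fun x => ∃ y, inField y S ∧ smem (spair x y) B) (mk _)
      hr.1 ⟨s, hs.1, hrs⟩ (fun b c _ h hcb => by
        obtain ⟨y, _, hy⟩ := h
        obtain ⟨z, hz, hz'⟩ := (hB _ _ hy).1 c hcb
        exact ⟨z, ⟨y, Or.inl hz⟩, hz'⟩) ((top_wtop hr).2 x hx)
    obtain ⟨y, h1, h2⟩ := this
    exact ⟨y, (hf2 _ _).2 ⟨hx, h1, h2⟩⟩
  · intro x y y' h1 h2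
    obtain ⟨_, a2, a3⟩ := (hf2 _ _).1 h1
    obtain ⟨_, b2, b3⟩ := (hf2 _ _).1 h2
    exact bis_fun hS hB a3 b3 a2 b2
  · intro x x' y h1 h2
    obtain ⟨a1, a2, a3⟩ := (hf2 _ _).1 h1
    obtain ⟨b1, b2, b3⟩ := (hf2 _ _).1 h2
    exact bis_inj hR hB a3 b3 a1 b1
  · intro x hx
    have := seg_ind (R := S) (a := s) (x := x) (fun x => ∃ y, inField y R ∧ smem (spair y x) B) (mk _)
      hs.1 ⟨r, hr.1, hrs⟩ (fun b c _ h hcb => by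
        obtain ⟨y, _, hy⟩ := h
        obtain ⟨z, hz, hz'⟩ := (hB _ _ hy).2 c hcb
        exact ⟨z, ⟨y, Or.inl hz⟩, hz'⟩) ((top_wtop hs).2 x hx)
    obtain ⟨y, h1, h2⟩ := this
    exact ⟨y, (hf2 _ _).2 ⟨h1, hx, h2⟩⟩
  · intro x y x' y' h1 h2
    obtain ⟨a1, a2, a3⟩ := (hf2 _ _).1 h1
    obtain ⟨b1, b2, b3⟩ := (hf2 _ _).1 h2
    constructor
    · intro h
      obtain ⟨z, hz, hz'⟩ := (hB _ _ b3).1 x h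
      rwa [bis_fun hS hB a3 hz' a2 ⟨y', Or.inl hz⟩]
    · intro h
      obtain ⟨z, hz, hz'⟩ := (hB _ _ b3).2 x' h
      rwa [bis_inj hR hB a3 hz' a1 ⟨y, Or.inl hz⟩]

theorem seg_self (R a : M) : inSeg a R a := fun _ _ _ h _ => h

theorem seg_step {R a b c : M} (h : inSeg b R a) (hc : smem (spair c b) R) : inSeg c R a :=
  fun B h1 h2 h3 h4 => h4 b c (h B h1 h2 h3 h4) hc

theorem seg_trans {R a b c : M} (h : inSeg c R b) (h' : inSeg b R a) : inSeg c R a :=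
  fun B h1 h2 h3 h4 => h B h1 h2 (h' B h1 h2 h3 h4) h4

theorem seg_field {R a x : M} (ha : inField a R) (h : inSeg x R a) : inField x R :=
  seg_ind (R := R) (a := a) (fun x => inField x R) (mk _) ha ha (fun b c _ _ h => ⟨b, Or.inl h⟩) h

theorem seg_cases {R a x : M} (ha : inField a R) (h : inSeg x R a) :
    x = a ∨ ∃ u, smem (spair u a) R ∧ inSeg x R u := by
  refine seg_ind (R := R) (a := a) (fun x => x = a ∨ ∃ u, smem (spair u a) R ∧ inSeg x R u) (mk _)
    ha (Or.inl rfl) ?_ h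
  rintro b c _ (rfl | ⟨u, hu, hb⟩) hc
  · exact Or.inr ⟨c, hc, seg_self _ _⟩
  · exact Or.inr ⟨u, hu, seg_step hb hc⟩

theorem no_cycle {R u a : M} (hR : isBFEXT R) (h : smem (spair u a) R) (h' : inSeg a R u) :
    False := by
  obtain ⟨B, hB, hm⟩ := mk (fun x => inField x R ∧ ∃ y, smem (spair y x) R ∧ inSeg x R y)
  obtain ⟨x, hx, hmin⟩ := hR.2.1 B hB ⟨a, (hm a).2 ⟨⟨u, Or.inr h⟩, u, h, h'⟩⟩
    fun b hb => ((hm b).1 hb).1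
  obtain ⟨_, y, hy, hxy⟩ := (hm x).1 hx
  have hyR : inField y R := ⟨x, Or.inl hy⟩
  refine hmin y ((hm y).2 ⟨hyR, ?_⟩) hy
  rcases seg_cases hyR hxy with rfl | ⟨v, hv, hxv⟩
  · exact ⟨x, hy, seg_self _ _⟩
  · exact ⟨v, hv, seg_step hxv hy⟩

theorem wtop_unique {Y y y' : M} (hY : isBFEXT Y) (h : wtop y Y) (h' : wtop y' Y) : y = y' := by
  rcases seg_cases h'.1 (h'.2 y h.1) with e | ⟨u, hu, hyu⟩
  · exact e
  · exact (no_cycle hY hu (seg_trans (h.2 y' h'.1) hyu)).elim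

theorem iso_mem {f R S x y : M} (hf : isIsoRel f R S) (h : smem (spair x y) f) :
    inField x R ∧ inField y S := by
  obtain ⟨a, b, e, ha, hb⟩ := hf.2.1 _ h
  obtain ⟨rfl, rfl⟩ := pair_inj.1 e
  exact ⟨ha, hb⟩

theorem iso_refl (R : M) : relIso R R := by
  obtain ⟨f, hf, hf1, hf2⟩ := mkRel (fun u v => inField u R ∧ u = v) (mk _)
  refine ⟨f, hf, ?_, ?_, ?_, ?_, ?_, ?_⟩
  · intro p hp
    obtain ⟨a, b, e, ha, rfl⟩ := hf1 p hp
    exact ⟨a, a, e, ha, ha⟩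
  · exact fun x hx => ⟨x, (hf2 _ _).2 ⟨hx, rfl⟩⟩
  · exact fun x y y' h h' => ((hf2 _ _).1 h).2.symm.trans ((hf2 _ _).1 h').2
  · exact fun x x' y h h' => ((hf2 _ _).1 h).2.trans ((hf2 _ _).1 h').2.symm
  · exact fun x hx => ⟨x, (hf2 _ _).2 ⟨hx, rfl⟩⟩
  · intro x y x' y' h h'
    obtain ⟨_, rfl⟩ := (hf2 _ _).1 h
    obtain ⟨_, rfl⟩ := (hf2 _ _).1 h'
    exact Iff.rfl

theorem iso_symm {R S : M} (h : relIso R S) : relIso S R := by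
  obtain ⟨f, hf⟩ := h
  obtain ⟨g, hg, hg1, hg2⟩ := mkRel (fun u v => smem (spair v u) f) (mk _)
  refine ⟨g, hg, ?_, ?_, ?_, ?_, ?_, ?_⟩
  · intro p hp
    obtain ⟨a, b, e, h⟩ := hg1 p hp
    exact ⟨a, b, e, (iso_mem hf h).2, (iso_mem hf h).1⟩
  · simpa only [hg2] using hf.2.2.2.2.2.1
  · simp only [hg2]
    exact fun x y y' h h' => hf.2.2.2.2.1 _ _ _ h h'
  · simp only [hg2]
    exact fun x y y' h h' => hf.2.2.2.1 _ _ _ h h'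
  · simpa only [hg2] using hf.2.2.1
  · simp only [hg2]
    exact fun x y x' y' h h' => (hf.2.2.2.2.2.2 _ _ _ _ h h').symm

theorem iso_trans {R S U : M} (h : relIso R S) (h' : relIso S U) : relIso R U := by
  obtain ⟨f, hf⟩ := h
  obtain ⟨g, hg⟩ := h'
  obtain ⟨k, hk, hk1, hk2⟩ := mkRel (fun u v => ∃ w, smem (spair u w) f ∧ smem (spair w v) g) (mk _)
  refine ⟨k, hk, ?_, ?_, ?_, ?_, ?_, ?_⟩
  · intro p hp
    obtain ⟨a, b, e, w, h1, h2⟩ := hk1 p hp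
    exact ⟨a, b, e, (iso_mem hf h1).1, (iso_mem hg h2).2⟩
  · intro x hx
    obtain ⟨w, hw⟩ := hf.2.2.1 x hx
    obtain ⟨y, hy⟩ := hg.2.2.1 w (iso_mem hf hw).2
    exact ⟨y, (hk2 _ _).2 ⟨w, hw, hy⟩⟩
  · simp only [hk2]
    rintro x y y' ⟨w, h1, h2⟩ ⟨w', h3, h4⟩
    obtain rfl := hf.2.2.2.1 _ _ _ h1 h3
    exact hg.2.2.2.1 _ _ _ h2 h4
  · simp only [hk2]
    rintro x x' y ⟨w, h1, h2⟩ ⟨w', h3, h4⟩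
    obtain rfl := hg.2.2.2.2.1 _ _ _ h2 h4
    exact hf.2.2.2.2.1 _ _ _ h1 h3
  · intro y hy
    obtain ⟨w, hw⟩ := hg.2.2.2.2.2.1 y hy
    obtain ⟨x, hx⟩ := hf.2.2.2.2.2.1 w (iso_mem hg hw).1
    exact ⟨x, (hk2 _ _).2 ⟨w, hx, hw⟩⟩
  · simp only [hk2]
    rintro x y x' y' ⟨w, h1, h2⟩ ⟨w', h3, h4⟩
    exact (hf.2.2.2.2.2.2 _ _ _ _ h1 h3).trans (hg.2.2.2.2.2.2 _ _ _ _ h2 h4)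

theorem wtop_iso {f R S y y' : M} (hf : isIsoRel f R S) (hy : wtop y R)
    (h : smem (spair y y') f) : wtop y' S := by
  refine ⟨(iso_mem hf h).2, fun x' hx' => ?_⟩
  obtain ⟨x, hx⟩ := hf.2.2.2.2.2.1 x' hx'
  intro B' hB' hB1 hB2 hB3
  have := seg_ind (R := R) (a := y) (x := x) (fun z => ∃ z', smem z' B' ∧ smem (spair z z') f) (mk _)
    hy.1 ⟨y', hB2, h⟩ (fun b c _ hb hc => by
      obtain ⟨b', h1, h2⟩ := hb
      obtain ⟨c', hc'⟩ := hf.2.2.1 c ⟨b, Or.inl hc⟩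
      exact ⟨c', hB3 b' c' h1 ((hf.2.2.2.2.2.2 _ _ _ _ hc' h2).1 hc), hc'⟩)
    (hy.2 x (iso_mem hf hx).1)
  obtain ⟨z', h1, h2⟩ := this
  rwa [hf.2.2.2.1 _ _ _ hx h2]

theorem seg_pair {sg R x : M} (hs : isSegOf sg R x) {c b : M} :
    smem (spair c b) sg ↔ smem (spair c b) R ∧ inSeg b R x := by
  rw [hs.2]
  constructor
  · rintro ⟨h, u, v, e, _, hv⟩
    obtain ⟨rfl, rfl⟩ := pair_inj.1 e
    exact ⟨h, hv⟩
  · rintro ⟨h, hb⟩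
    exact ⟨h, c, b, rfl, seg_step hb h, hb⟩

theorem seg_fld {sg R x y : M} (hs : isSegOf sg R x) (hy : smem (spair y x) R) {z : M} :
    inField z sg ↔ inSeg z R x := by
  constructor
  · rintro ⟨w, h | h⟩
    · obtain ⟨h1, h2⟩ := (seg_pair hs).1 h
      exact seg_step h2 h1
    · exact ((seg_pair hs).1 h).2
  · intro h
    refine seg_ind (R := R) (a := x) (x := z) (fun z => inField z sg ∧ inSeg z R x) (mk _) ⟨y, Or.inr hy⟩
      ⟨⟨y, Or.inr ((seg_pair hs).2 ⟨hy, seg_self _ _⟩)⟩, seg_self _ _⟩ ?_ h |>.1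
    rintro b c _ ⟨_, hb⟩ hc
    exact ⟨⟨b, Or.inl ((seg_pair hs).2 ⟨hc, hb⟩)⟩, seg_step hb hc⟩

theorem seg_wtop {sg R x y : M} (hs : isSegOf sg R x) (hy : smem (spair y x) R) : wtop x sg := by
  refine ⟨(seg_fld hs hy).2 (seg_self _ _), fun z hz => ?_⟩
  intro B hB h1 h2 h3
  refine (seg_fld hs hy).1 hz B hB (fun b hb => ?_) h2 fun b c hb hc => ?_
  · exact seg_field ⟨y, Or.inr hy⟩ ((seg_fld hs hy).1 (h1 b hb))
  · exact h3 b c hb ((seg_pair hs).2 ⟨hc, (seg_fld hs hy).1 (h1 b hb)⟩)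

theorem seg_bfext {sg R x y : M} (hR : isBFEXT R) (hs : isSegOf sg R x) (hy : smem (spair y x) R) :
    isBFEXT sg := by
  refine ⟨⟨hs.1, fun p hp => ?_⟩, fun B hB hne hf => ?_, fun a b ha hb h => ?_⟩
  · exact hR.1.2 p ((hs.2 p).1 hp).1
  · obtain ⟨b, hb, hm⟩ := hR.2.1 B hB hne fun b hb =>
      seg_field ⟨y, Or.inr hy⟩ ((seg_fld hs hy).1 (hf b hb))
    exact ⟨b, hb, fun c hc h => hm c hc ((seg_pair hs).1 h).1⟩
  · rw [seg_fld hs hy] at ha hb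
    refine hR.2.2 a b (seg_field ⟨y, Or.inr hy⟩ ha) (seg_field ⟨y, Or.inr hy⟩ hb) fun c => ?_
    have := h c
    rw [seg_pair hs, seg_pair hs] at this
    tauto

theorem wtop_top {R x : M} (hR : sset R) (hR' : ∀ p, smem p R → ∃ x y, p = spair x y)
    (h : wtop x R) : isTopOf x R := by
  refine ⟨h.1, hR, fun p => ⟨fun hp => ⟨hp, ?_⟩, fun hp => hp.1⟩⟩
  obtain ⟨u, v, rfl⟩ := hR' p hp
  exact ⟨u, v, rfl, h.2 u ⟨v, Or.inl hp⟩, h.2 v ⟨u, Or.inr hp⟩⟩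

theorem exists_seg (R x : M) : ∃ sg : M, isSegOf sg R x := 
  mk (fun p => smem p R ∧ ∃ u v, p = spair u v ∧ inSeg u R x ∧ inSeg v R x)

theorem exists_type (R : M) : ∃ t : M, isTypeOf t R := mk (fun S => relIso S R)

theorem ext_half {a a' R S r s u : M} (hR : isBFEXT R) (hr : isTopOf r R) (ha : isTypeOf a R)
    (hS : isBFEXT S) (hs : isTopOf s S) (ha' : isTypeOf a' S)
    (hE : ∀ b, inBF b → erel b a → erel b a') (hF : flag a → flag a')
    (hu : smem (spair u r) R) : ∃ v, smem (spair v s) S ∧ ∃ B, Bis B R S ∧ smem (spair u v) B := by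
  by_cases hmin : ∃ y, smem (spair y u) R
  · obtain ⟨y, hy⟩ := hmin
    obtain ⟨sg, hsg⟩ := exists_seg R u
    have hsB := seg_bfext hR hsg hy
    have hsw := seg_wtop hsg hy
    have hst := wtop_top hsg.1 (hsB.1.2) hsw
    obtain ⟨β, hβ⟩ := exists_type sg
    obtain ⟨R1, S1, hR1, hS1, v1, s1, hs1, hv1, sg1, hsg1, hi⟩ := hE β ⟨sg, ⟨hsB, u, hst⟩, hβ⟩
      ⟨sg, R, (hβ.2 _).2 (iso_refl _), (ha.2 _).2 (iso_refl _), u, r, hr, hu, sg, hsg, iso_refl _⟩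
    obtain ⟨j, hj⟩ := (ha'.2 _).1 hS1
    obtain ⟨k, hk⟩ := iso_trans (iso_symm ((hβ.2 _).1 hR1)) hi
    have hv1f : inField v1 S1 := ⟨s1, Or.inl hv1⟩
    -- `v1` has a predecessor
    have hy1 : ∃ y1, smem (spair y1 v1) S1 := by
      obtain ⟨w, hw⟩ := hk.2.2.1 u hsw.1
      by_contra hno
      have key : ∀ z, inSeg z S1 v1 → z = v1 := fun z hz => by
        rcases seg_cases hv1f hz with e | ⟨x, hx, _⟩
        · exact e
        · exact absurd ⟨x, hx⟩ hno
      obtain ⟨z, hz | hz⟩ := (iso_mem hk hw).2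
      · obtain ⟨h1, h2⟩ := (seg_pair hsg1).1 hz
        exact hno ⟨w, key z h2 ▸ h1⟩
      · obtain ⟨h1, h2⟩ := (seg_pair hsg1).1 hz
        exact hno ⟨z, key w h2 ▸ h1⟩
    obtain ⟨y1, hy1⟩ := hy1
    have hw1 := seg_wtop hsg1 hy1
    have hkuv : smem (spair u v1) k := by
      obtain ⟨w, hw⟩ := hk.2.2.2.2.2.1 v1 hw1.1
      obtain ⟨k', hk'⟩ := iso_symm ⟨k, hk⟩
      obtain ⟨w, hw⟩ := hk'.2.2.1 v1 hw1.1
      -- use the converse isomorphism and then uniqueness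
      obtain ⟨k2, hk2s, hk21, hk22⟩ := mkRel (fun x y => smem (spair y x) k) (mk _)
      obtain ⟨w, hw⟩ := hk.2.2.2.2.2.1 v1 hw1.1
      have hk2 : isIsoRel k2 sg1 sg := by
        refine ⟨hk2s, ?_, ?_, ?_, ?_, ?_, ?_⟩
        · intro p hp
          obtain ⟨a, b, e, h⟩ := hk21 p hp
          exact ⟨a, b, e, (iso_mem hk h).2, (iso_mem hk h).1⟩
        · simpa only [hk22] using hk.2.2.2.2.2.1
        · simp only [hk22]
          exact fun x y y' h h' => hk.2.2.2.2.1 _ _ _ h h'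
        · simp only [hk22]
          exact fun x y y' h h' => hk.2.2.2.1 _ _ _ h h'
        · simpa only [hk22] using hk.2.2.1
        · simp only [hk22]
          exact fun x y x' y' h h' => (hk.2.2.2.2.2.2 _ _ _ _ h h').symm
      have := wtop_iso hk2 hw1 ((hk22 _ _).2 hw)
      rwa [wtop_unique hsB hsw this]
    obtain ⟨s', hs'⟩ := hj.2.2.1 s1 ⟨v1, Or.inr hv1⟩
    have hs's : s' = s := wtop_unique hS (wtop_iso hj (top_wtop hs1) hs') (top_wtop hs)
    subst hs's
    obtain ⟨v, hv⟩ := hj.2.2.1 v1 hv1f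
    refine ⟨v, (hj.2.2.2.2.2.2 _ _ _ _ hv hs').1 hv1, ?_⟩
    obtain ⟨B, hB, hB1, hB2⟩ := mkRel (fun u v => ∃ w, smem (spair u w) k ∧ smem (spair w v) j) (mk _)
    refine ⟨B, ?_, (hB2 _ _).2 ⟨v1, hkuv, hv⟩⟩
    intro x z hxz
    obtain ⟨w, hxw, hwz⟩ := (hB2 _ _).1 hxz
    constructor
    · intro x' hx'
      have hx's : smem (spair x' x) sg :=
        (seg_pair hsg).2 ⟨hx', (seg_fld hsg hy).1 (iso_mem hk hxw).1⟩
      obtain ⟨w', hw'⟩ := hk.2.2.1 x' ⟨x, Or.inl hx's⟩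
      have h1 := (hk.2.2.2.2.2.2 _ _ _ _ hw' hxw).1 hx's
      have h2 := ((seg_pair hsg1).1 h1).1
      obtain ⟨z', hz'⟩ := hj.2.2.1 w' ⟨w, Or.inl h2⟩
      exact ⟨z', (hj.2.2.2.2.2.2 _ _ _ _ hz' hwz).1 h2, (hB2 _ _).2 ⟨w', hw', hz'⟩⟩
    · intro z' hz'
      obtain ⟨w', hw'⟩ := hj.2.2.2.2.2.1 z' ⟨z, Or.inl hz'⟩
      have h2 := (hj.2.2.2.2.2.2 _ _ _ _ hw' hwz).2 hz'
      have h3 : smem (spair w' w) sg1 :=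
        (seg_pair hsg1).2 ⟨h2, (seg_fld hsg1 hy1).1 (iso_mem hk hxw).2⟩
      obtain ⟨x', hx'⟩ := hk.2.2.2.2.2.1 w' ⟨w, Or.inl h3⟩
      have h4 := (hk.2.2.2.2.2.2 _ _ _ _ hx' hxw).2 h3
      exact ⟨x', ((seg_pair hsg).1 h4).1, (hB2 _ _).2 ⟨w', hx', hw'⟩⟩
  · obtain ⟨S1, x1, s1, hS1, hs1, hx1, hm1⟩ := hF ⟨R, u, r, (ha.2 _).2 (iso_refl _), hr, hu,
      fun z hz => hmin ⟨z, hz⟩⟩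
    obtain ⟨j, hj⟩ := (ha'.2 _).1 hS1
    obtain ⟨s', hs'⟩ := hj.2.2.1 s1 ⟨x1, Or.inr hx1⟩
    have hs's : s' = s := wtop_unique hS (wtop_iso hj (top_wtop hs1) hs') (top_wtop hs)
    subst hs's
    obtain ⟨v, hv⟩ := hj.2.2.1 x1 ⟨s1, Or.inl hx1⟩
    obtain ⟨B, hB, hB1⟩ := mk (fun p => p = spair u v)
    refine ⟨v, (hj.2.2.2.2.2.2 _ _ _ _ hv hs').1 hx1, B, ?_, (hB1 _).2 rfl⟩
    intro x z hxz
    obtain ⟨rfl, rfl⟩ := pair_inj.1 ((hB1 _).1 hxz)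
    refine ⟨fun x' hx' => absurd ⟨x', hx'⟩ hmin, fun z' hz' => ?_⟩
    obtain ⟨w', hw'⟩ := hj.2.2.2.2.2.1 z' ⟨z, Or.inl hz'⟩
    exact absurd ((hj.2.2.2.2.2.2 _ _ _ _ hw' hv).2 hz') (hm1 w')

theorem E_ext {a a' : M} (ha : inBF a) (ha' : inBF a')
    (hE : ∀ b, inBF b → (erel b a ↔ erel b a')) (hF : flag a ↔ flag a') : a = a' := by
  obtain ⟨R, ⟨hR, r, hr⟩, hRa⟩ := ha
  obtain ⟨S, ⟨hS, s, hs⟩, hSa⟩ := ha'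
  have h1 : ∀ u, smem (spair u r) R → ∃ v, smem (spair v s) S ∧ ∃ B, Bis B R S ∧ smem (spair u v) B :=
    fun u hu => ext_half hR hr hRa hS hs hSa (fun b hb => (hE b hb).1) hF.1 hu
  have h2 : ∀ u, smem (spair u s) S → ∃ v, smem (spair v r) R ∧ ∃ B, Bis B S R ∧ smem (spair u v) B :=
    fun u hu => ext_half hS hs hSa hR hr hRa (fun b hb => (hE b hb).2) hF.2 hu
  obtain ⟨B, hB, _, hB1⟩ := mkRel (fun u v => (∃ B, Bis B R S ∧ smem (spair u v) B) ∨ (u = r ∧ v = s)) (mk _)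
  have hBis : Bis B R S := by
    intro u v huv
    rcases (hB1 _ _).1 huv with ⟨B', hB', h⟩ | ⟨rfl, rfl⟩
    · constructor
      · intro u' hu'
        obtain ⟨v', h3, h4⟩ := (hB' _ _ h).1 u' hu'
        exact ⟨v', h3, (hB1 _ _).2 (Or.inl ⟨B', hB', h4⟩)⟩
      · intro u' hu'
        obtain ⟨v', h3, h4⟩ := (hB' _ _ h).2 u' hu'
        exact ⟨v', h3, (hB1 _ _).2 (Or.inl ⟨B', hB', h4⟩)⟩
    · constructor
      · intro u' hu'
        obtain ⟨v', h3, h4⟩ := h1 u' hu'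
        exact ⟨v', h3, (hB1 _ _).2 (Or.inl h4)⟩
      · intro v' hv'
        obtain ⟨u', h3, B', hB', h4⟩ := h2 v' hv'
        obtain ⟨B2, hB2, hB2'⟩ := bis_conv hB'
        exact ⟨u', h3, (hB1 _ _).2 (Or.inl ⟨B2, hB2', (hB2 _ _).2 h4⟩)⟩
  have iso : relIso R S := topiso hR hS hr hs hBis ((hB1 _ _).2 (Or.inr ⟨rfl, rfl⟩))
  refine Good.ext hRa.1 hSa.1 fun T => ?_
  rw [hRa.2, hSa.2]
  exact ⟨fun h => iso_trans h iso, fun h => iso_trans h (iso_symm iso)⟩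

end Ext

section Main
variable {M : Type} [LNFU.Structure M]

/-- `mn` injects into some member of `b`, missing at least two points. -/
def Cl (mn b : M) : Prop := ∃ Y h y0 y1, smem Y b ∧ isInjFunc h mn Y ∧ smem y0 Y ∧ smem y1 Y ∧
  y0 ≠ y1 ∧ ∀ x, ¬ smem (spair x y0) h ∧ ¬ smem (spair x y1) h

theorem SF_Cl {E : Type} {Γ : Cx M E} {k : ℕ} {a b : E → M} (h1 : TT Γ a (k + 1))
    (h2 : TT Γ b (k + 2)) : SF Γ (fun e => Cl (a e) (b e)) := by
  unfold Cl; exact strat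

variable [Good M]

theorem step {b b' mn mn' : M} (hb : Cl mn b) (h2 : isTwoPowOf b' b)
    (hmn : ∀ a, smem a mn' ↔ (inBF a ∧ ∀ β, inBF β → erel β a → smem β mn)) : Cl mn' b' := by
  obtain ⟨Y, h, y0, y1, hYb, hh, hy0, hy1, hne, hmiss⟩ := hb
  obtain ⟨X0, Y0, P, hι, hbY, hP, hb'⟩ := h2
  obtain ⟨φ, hφ, hφs⟩ := (hbY.2 Y).1 hYb
  obtain ⟨k, hk, hk2⟩ := inj_of (X := mn) (Y := Y0)
    (fun x z => ∃ y, smem (spair x y) h ∧ smem (spair y z) φ) (mk _)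
    (fun a ha => by
      obtain ⟨y, hy⟩ := hh.1.2.2.1 a ha
      obtain ⟨z, hz⟩ := hφ.1.2.2.1 y (hh.1.mem hy).2
      exact ⟨z, (hφ.1.mem hz).2, y, hy, hz⟩)
    (by
      rintro a b b' _ _ _ ⟨y, h1, h2⟩ ⟨y', h3, h4⟩
      obtain rfl := hh.1.2.2.2 _ _ _ h1 h3
      exact hφ.1.2.2.2 _ _ _ h2 h4)
    (by
      rintro a b b' _ _ _ ⟨y, h1, h2⟩ ⟨y', h3, h4⟩
      obtain rfl := hφ.2 _ _ _ h2 h4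
      exact hh.2 _ _ _ h1 h3)
  obtain ⟨s0, hs0⟩ := hφ.1.2.2.1 y0 hy0
  obtain ⟨s1, hs1⟩ := hφ.1.2.2.1 y1 hy1
  have hm0 : ∀ x, ¬ smem (spair x s0) k := by
    intro x hx
    obtain ⟨_, _, y, h1, h2⟩ := (hk2 _ _).1 hx
    obtain rfl := hφ.2 _ _ _ h2 hs0
    exact (hmiss x).1 h1
  have hm1 : ∀ x, ¬ smem (spair x s1) k := by
    intro x hx
    obtain ⟨_, _, y, h1, h2⟩ := (hk2 _ _).1 hx
    obtain rfl := hφ.2 _ _ _ h2 hs1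
    exact (hmiss x).2 h1
  obtain ⟨x0, hx0, hsx0⟩ := (hι.2 s0).1 (hφ.1.mem hs0).2
  obtain ⟨x1, hx1, hsx1⟩ := (hι.2 s1).1 (hφ.1.mem hs1).2
  have hx01 : x0 ≠ x1 := by
    rintro rfl
    obtain rfl := single_unique hsx0 hsx1
    exact hne (hφ.2 _ _ _ hs0 hs1)
  have hd : ∀ β x sx, smem (spair β sx) k → isSingletonOf sx x → x ≠ x0 ∧ x ≠ x1 := by
    intro β x sx h1 h2
    constructor
    · rintro rfl
      obtain rfl := single_unique h2 hsx0
      exact hm0 _ h1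
    · rintro rfl
      obtain rfl := single_unique h2 hsx1
      exact hm1 _ h1
  have key : ∀ a a' s, (∀ x, smem x s ↔ smem x X0 ∧ ((∃ β sx, smem (spair β sx) k ∧
      isSingletonOf sx x ∧ erel β a) ∨ (flag a ∧ x = x0))) →
      (∀ x, smem x s ↔ smem x X0 ∧ ((∃ β sx, smem (spair β sx) k ∧
      isSingletonOf sx x ∧ erel β a') ∨ (flag a' ∧ x = x0))) → smem a mn' →
      (∀ β, inBF β → erel β a → erel β a') ∧ (flag a → flag a') := by
    intro a a' s h1 h2 ha
    constructor
    · intro β hβ he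
      obtain ⟨sx, hsx⟩ := hk.1.2.2.1 β (((hmn a).1 ha).2 β hβ he)
      obtain ⟨x, hx, hxs⟩ := (hι.2 sx).1 (hk.1.mem hsx).2
      have hxs' : smem x s := (h1 x).2 ⟨hx, Or.inl ⟨β, sx, hsx, hxs, he⟩⟩
      rcases (h2 x).1 hxs' with ⟨_, ⟨β', sx', h3, h4, h5⟩ | ⟨_, e⟩⟩
      · obtain rfl := single_unique hxs h4
        obtain rfl := hk.2 _ _ _ hsx h3
        exact h5
      · exact absurd e (hd β x sx hsx hxs).1
    · intro hf
      have hxs' : smem x0 s := (h1 x0).2 ⟨hx0, Or.inr ⟨hf, rfl⟩⟩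
      rcases (h2 x0).1 hxs' with ⟨_, ⟨β', sx', h3, h4, h5⟩ | ⟨hf', e⟩⟩
      · exact absurd rfl (hd _ _ _ h3 h4).1
      · exact hf'
  obtain ⟨h', hh', hh2⟩ := inj_of (X := mn') (Y := P)
    (fun a s => sset s ∧ ∀ x, smem x s ↔ smem x X0 ∧ ((∃ β sx, smem (spair β sx) k ∧
      isSingletonOf sx x ∧ erel β a) ∨ (flag a ∧ x = x0))) (mk _)
    (fun a ha => by
      obtain ⟨s, hs, hs'⟩ := mk (fun x => smem x X0 ∧ ((∃ β sx, smem (spair β sx) k ∧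
        isSingletonOf sx x ∧ erel β a) ∨ (flag a ∧ x = x0)))
      exact ⟨s, (hP.2 s).2 ⟨hs, fun w hw => ((hs' w).1 hw).1⟩, hs, hs'⟩)
    (by
      rintro a s s' _ _ _ ⟨h1, h2⟩ ⟨h3, h4⟩
      exact Good.ext h1 h3 fun x => (h2 x).trans (h4 x).symm)
    (by
      rintro a a' s ha ha' _ ⟨h1, h2⟩ ⟨h3, h4⟩
      obtain ⟨k1, k2⟩ := key a a' s h2 h4 ha
      obtain ⟨k3, k4⟩ := key a' a s h4 h2 ha'
      exact E_ext ((hmn a).1 ha).1 ((hmn a').1 ha').1 (fun β hβ => ⟨k1 β hβ, k3 β hβ⟩) ⟨k2, k4⟩)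
  obtain ⟨p0, hp0, hp0'⟩ := mk (fun x => x = x1)
  obtain ⟨p1, hp1, hp1'⟩ := mk (fun x => x = x0 ∨ x = x1)
  have hx1no : ∀ a s, smem (spair a s) h' → ¬ smem x1 s := by
    intro a s has hx
    obtain ⟨_, _, _, h2⟩ := (hh2 _ _).1 has
    rcases (h2 x1).1 hx with ⟨_, ⟨β', sx', h3, h4, h5⟩ | ⟨hf', e⟩⟩
    · exact absurd rfl (hd _ _ _ h3 h4).2
    · exact absurd e.symm hx01
  refine ⟨P, h', p0, p1, (hb'.2 P).2 (eqp_refl P), hh', (hP.2 _).2 ⟨hp0, ?_⟩, (hP.2 _).2 ⟨hp1, ?_⟩, ?_,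
    fun a => ⟨fun h => hx1no _ _ h ((hp0' _).2 rfl), fun h => hx1no _ _ h ((hp1' _).2 (Or.inr rfl))⟩⟩
  · intro w hw
    rwa [(hp0' w).1 hw]
  · intro w hw
    rcases (hp1' w).1 hw with e | e <;> rwa [e]
  · rintro rfl
    exact hx01 ((hp0' x0).1 ((hp1' x0).2 (Or.inl rfl)))

theorem main_of_base (hbase : ∀ y N c : M, isM0Set y → isNatSet N → isCardOf c N → Cl y c)
    {g f : M} (hg : isMFun g) (hf : isBethFun f) {n : M} (hn : isNat n) :
    ∀ t b mn, isTOf t n → smem (spair t b) f → ¬ isEmptySet b → smem (spair n mn) g → Cl mn b := by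
  refine nat_ind (fun n => ∀ t b mn, isTOf t n → smem (spair t b) f → ¬ isEmptySet b →
    smem (spair n mn) g → Cl mn b) (mk _) ?_ ?_ hn
  · intro z hz t b mn ht hb _ hmn
    obtain ⟨N, hN, hc⟩ := hf.2.2.2.2.1 t b (T_zero hz ht) hb
    exact hbase mn N b (hg.2.2.2.2.1 z mn hz hmn) hN hc
  · intro a n' ha ih hs t b mn ht hb hbne hmn
    obtain ⟨t0, ht0, hst⟩ := T_succ hs ht
    have hnt0 : isNat t0 := T_nat ha t0 ht0
    obtain ⟨b0, hb0⟩ := hf.2.2.1 t0 hnt0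
    obtain ⟨m0, hm0⟩ := hg.2.2.1 a ha
    rcases hf.2.2.2.2.2 t0 t b0 b hnt0 hst hb0 hb with ⟨_, h⟩ | ⟨hne, h | ⟨h, _⟩⟩
    · exact absurd h hbne
    · exact step (ih t0 b0 m0 ht0 hb0 hne hm0) h (hg.2.2.2.2.2 a n' m0 mn ha hs hm0 hmn).2
    · exact absurd h hbne

end Main

section Fin
variable {M : Type} [LNFU.Structure M]

/-- Internal (Kuratowski-style) finiteness. -/
def FinSet (X : M) : Prop := sset X ∧ ∀ K, (∀ e, isEmptySet e → smem e K) →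
  (∀ Y z Y', smem Y K → sset Y' → (∀ u, smem u Y' ↔ smem u Y ∨ u = z) → smem Y' K) → smem X K

theorem SF_FinSet {E : Type} {Γ : Cx M E} {k : ℕ} {X : E → M} (h1 : TT Γ X (k + 1)) :
    SF Γ (fun e => FinSet (X e)) := by
  unfold FinSet; exact strat

theorem SF_isPowerSetOf {E : Type} {Γ : Cx M E} {k : ℕ} {P X : E → M} (h1 : TT Γ P (k + 2))
    (h2 : TT Γ X (k + 1)) : SF Γ (fun e => isPowerSetOf (P e) (X e)) := by
  unfold isPowerSetOf; exact strat

theorem SF_isProdOf {E : Type} {Γ : Cx M E} {k : ℕ} {P X Y : E → M} (h1 : TT Γ P (k + 1))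
    (h2 : TT Γ X (k + 1)) (h3 : TT Γ Y (k + 1)) :
    SF Γ (fun e => isProdOf (P e) (X e) (Y e)) := by
  unfold isProdOf; exact strat

variable [Good M]

theorem fin_empty {e : M} (h : isEmptySet e) : FinSet e := ⟨h.1, fun _ h1 _ => h1 e h⟩

theorem fin_adj {Y z Y' : M} (h : FinSet Y) (hY' : sset Y') (hm : ∀ u, smem u Y' ↔ smem u Y ∨ u = z) :
    FinSet Y' :=
  ⟨hY', fun K h1 h2 => h2 Y z Y' (h.2 K h1 h2) hY' hm⟩

theorem fin_ind (P : M → Prop) (h : ∃ y : M, sset y ∧ ∀ x, smem x y ↔ FinSet x ∧ P x)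
    (h0 : ∀ e, isEmptySet e → P e)
    (h1 : ∀ Y z Y', FinSet Y → P Y → ¬ smem z Y → sset Y' →
      (∀ u, smem u Y' ↔ smem u Y ∨ u = z) → P Y') {X : M} (hX : FinSet X) : P X := by
  obtain ⟨K, hK, h⟩ := h
  refine ((h X).1 (hX.2 K (fun e he => (h e).2 ⟨fin_empty he, h0 e he⟩) ?_)).2
  intro Y z Y' hY hY' hm
  obtain ⟨hF, hP⟩ := (h Y).1 hY
  refine (h Y').2 ⟨fin_adj hF hY' hm, ?_⟩
  by_cases hz : smem z Y
  · have : Y' = Y := Good.ext hY' hF.1 fun u => by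
      rw [hm]
      constructor
      · rintro (h | rfl) <;> assumption
      · exact Or.inl
    rwa [this]
  · exact h1 Y z Y' hF hP hz hY' hm

theorem fin_subset {X Z : M} (hX : FinSet X) (hZ : sset Z) (h : ∀ u, smem u Z → smem u X) :
    FinSet Z := by
  refine fin_ind (fun X => ∀ Z, sset Z → (∀ u, smem u Z → smem u X) → FinSet Z) (mk _) ?_ ?_ hX Z hZ h
  · intro e he Z hZ h
    exact fin_empty ⟨hZ, fun z hz => he.2 z (h z hz)⟩
  · intro Y z Y' _ ih _ _ hm Z hZ h
    obtain ⟨d, hd, hd'⟩ := exists_remove Z z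
    have hdf : FinSet d := ih d hd fun u hu => by
      obtain ⟨h1, h2⟩ := (hd' u).1 hu
      exact ((hm u).1 (h u h1)).resolve_right h2
    by_cases hz : smem z Z
    · refine fin_adj (z := z) hdf hZ fun u => ?_
      rw [hd']
      constructor
      · intro hu
        by_cases e : u = z
        · exact Or.inr e
        · exact Or.inl ⟨hu, e⟩
      · rintro (h | rfl)
        · exact h.1
        · exact hz
    · have : Z = d := Good.ext hZ hd fun u => by
        rw [hd']
        exact ⟨fun hu => ⟨hu, fun e => hz (e ▸ hu)⟩, fun h => h.1⟩
      rwa [this]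

theorem fin_union {X Y Z : M} (hX : FinSet X) (hY : FinSet Y) (hZ : sset Z)
    (h : ∀ u, smem u Z ↔ smem u X ∨ smem u Y) : FinSet Z := by
  refine fin_ind (fun X => ∀ Z, sset Z → (∀ u, smem u Z ↔ smem u X ∨ smem u Y) → FinSet Z)
    (mk _) ?_ ?_ hX Z hZ h
  · intro e he Z hZ h
    refine fin_subset hY hZ fun u hu => ((h u).1 hu).resolve_left (he.2 u)
  · intro X z X' _ ih _ _ hm Z hZ h
    obtain ⟨d, hd, hd'⟩ := mk (fun u => smem u X ∨ smem u Y)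
    refine fin_adj (z := z) (ih d hd hd') hZ fun u => ?_
    rw [h, hm, hd']
    tauto

theorem fin_image {X Z f : M} (hX : FinSet X) (hf : ∀ u v v', smem (spair u v) f →
    smem (spair u v') f → v = v') (hZ : sset Z)
    (h : ∀ v, smem v Z ↔ ∃ u, smem u X ∧ smem (spair u v) f) : FinSet Z := by
  refine fin_ind (fun X => ∀ Z, sset Z → (∀ v, smem v Z ↔ ∃ u, smem u X ∧ smem (spair u v) f) →
    FinSet Z) (mk _) ?_ ?_ hX Z hZ h
  · intro e he Z hZ h
    refine fin_empty ⟨hZ, fun z hz => ?_⟩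
    obtain ⟨u, hu, _⟩ := (h z).1 hz
    exact he.2 u hu
  · intro X z X' _ ih _ _ hm Z hZ h
    obtain ⟨d, hd, hd'⟩ := mk (fun v => ∃ u, smem u X ∧ smem (spair u v) f)
    have hdf := ih d hd hd'
    by_cases hw : ∃ w, smem (spair z w) f
    · obtain ⟨w, hw⟩ := hw
      refine fin_adj (z := w) hdf hZ fun v => ?_
      rw [h, hd']
      constructor
      · rintro ⟨u, hu, huv⟩
        rcases (hm u).1 hu with h1 | rfl
        · exact Or.inl ⟨u, h1, huv⟩
        · exact Or.inr (hf _ _ _ huv hw)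
      · rintro (⟨u, hu, huv⟩ | rfl)
        · exact ⟨u, (hm u).2 (Or.inl hu), huv⟩
        · exact ⟨z, (hm z).2 (Or.inr rfl), hw⟩
    · refine fin_subset hdf hZ fun v hv => ?_
      obtain ⟨u, hu, huv⟩ := (h v).1 hv
      rcases (hm u).1 hu with h1 | rfl
      · exact (hd' v).2 ⟨u, h1, huv⟩
      · exact absurd ⟨v, huv⟩ hw

theorem fin_prod {X Y Z : M} (hX : FinSet X) (hY : FinSet Y) (hZ : isProdOf Z X Y) : FinSet Z := by
  refine fin_ind (fun X => ∀ Z, isProdOf Z X Y → FinSet Z) (mk _) ?_ ?_ hX Z hZ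
  · intro e he Z hZ
    refine fin_empty ⟨hZ.1, fun z hz => ?_⟩
    obtain ⟨u, _, hu, _⟩ := (hZ.2 z).1 hz
    exact he.2 u hu
  · intro X z X' _ ih _ _ hm Z hZ
    obtain ⟨d, hd, hd'⟩ := mk (fun p => ∃ a b, smem a X ∧ smem b Y ∧ p = spair a b)
    have hdf := ih d ⟨hd, hd'⟩
    obtain ⟨f, hf, _, hf2⟩ := mkRel (fun u v => v = spair z u) (mk _)
    obtain ⟨i, hi, hi'⟩ := mk (fun v => ∃ u, smem u Y ∧ smem (spair u v) f)
    have hif : FinSet i := fin_image hY (fun u v v' h h' => by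
      rw [hf2] at h h'
      exact h.trans h'.symm) hi hi'
    refine fin_union hdf hif hZ.1 fun p => ?_
    rw [hZ.2, hd', hi']
    simp only [hm, hf2]
    constructor
    · rintro ⟨a, b, ha | rfl, hb, rfl⟩
      · exact Or.inl ⟨a, b, ha, hb, rfl⟩
      · exact Or.inr ⟨b, hb, rfl⟩
    · rintro (⟨a, b, ha, hb, rfl⟩ | ⟨b, hb, rfl⟩)
      · exact ⟨a, b, Or.inl ha, hb, rfl⟩
      · exact ⟨z, b, Or.inr rfl, hb, rfl⟩

theorem fin_power {X Z : M} (hX : FinSet X) (hZ : isPowerSetOf Z X) : FinSet Z := by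
  refine fin_ind (fun X => ∀ Z, isPowerSetOf Z X → FinSet Z) (mk _) ?_ ?_ hX Z hZ
  · intro e he Z hZ
    obtain ⟨o, ho, ho'⟩ := mk (fun x : M => False)
    refine fin_adj (z := e) (fin_empty (e := o) ⟨ho, fun z hz => (ho' z).1 hz⟩) hZ.1 fun u => ?_
    rw [hZ.2, ho']
    constructor
    · rintro ⟨hu, hw⟩
      exact Or.inr (Good.ext hu he.1 fun z => ⟨fun h => hw z h, fun h => absurd h (he.2 z)⟩)
    · rintro (h | rfl)
      · exact h.elim
      · exact ⟨he.1, fun w hw => hw⟩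
  · intro X z X' _ ih _ _ hm Z hZ
    obtain ⟨d, hd, hd'⟩ := mk (fun A => sset A ∧ ∀ w, smem w A → smem w X)
    have hdf := ih d ⟨hd, hd'⟩
    obtain ⟨f, hf, _, hf2⟩ := mkRel (fun A B => sset B ∧ ∀ w, smem w B ↔ smem w A ∨ w = z) (mk _)
    obtain ⟨i, hi, hi'⟩ := mk (fun v => ∃ u, smem u d ∧ smem (spair u v) f)
    have hif : FinSet i := fin_image hdf (fun u v v' h h' => by
      rw [hf2] at h h'
      exact Good.ext h.1 h'.1 fun w => (h.2 w).trans (h'.2 w).symm) hi hi'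
    refine fin_union hdf hif hZ.1 fun B => ?_
    rw [hZ.2, hd', hi']
    simp only [hm, hf2, hd']
    constructor
    · rintro ⟨hB, hw⟩
      by_cases hz : smem z B
      · right
        obtain ⟨A, hA, hA'⟩ := exists_remove B z
        refine ⟨A, ⟨hA, fun w hwA => ?_⟩, hB, fun w => ?_⟩
        · obtain ⟨h1, h2⟩ := (hA' w).1 hwA
          exact (hw w h1).resolve_right h2
        · rw [hA']
          constructor
          · intro h
            by_cases e : w = z
            · exact Or.inr e
            · exact Or.inl ⟨h, e⟩
          · rintro (h | rfl)
            · exact h.1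
            · exact hz
      · left
        refine ⟨hB, fun w hwB => (hw w hwB).resolve_right ?_⟩
        rintro rfl
        exact hz hwB
    · rintro (⟨hB, hw⟩ | ⟨A, ⟨_, hA⟩, hB, hw⟩)
      · exact ⟨hB, fun w h => Or.inl (hw w h)⟩
      · refine ⟨hB, fun w h => ?_⟩
        rcases (hw w).1 h with h | h
        · exact Or.inl (hA w h)
        · exact Or.inr h

theorem pigeon {X f : M} (hX : FinSet X) (hf : isInjFunc f X X) :
    ∀ b, smem b X → ∃ a, smem (spair a b) f := by
  refine fin_ind (fun X => ∀ f, isInjFunc f X X → ∀ b, smem b X → ∃ a, smem (spair a b) f)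
    (mk _) ?_ ?_ hX f hf
  · intro e he f _ b hb
    exact absurd hb (he.2 b)
  · intro X z X' _ ih hz _ hm f hf b hb
    have hzX' : smem z X' := (hm z).2 (Or.inr rfl)
    obtain ⟨y, hy⟩ := hf.1.2.2.1 z hzX'
    have hne : ∀ x, smem x X → x ≠ z := by
      rintro x hx rfl
      exact hz hx
    have hsub : ∀ x, smem x X → smem x X' := fun x hx => (hm x).2 (Or.inl hx)
    have hdown : ∀ x, smem x X' → x ≠ z → smem x X := fun x hx h => ((hm x).1 hx).resolve_right h
    obtain ⟨g, hg, hg2⟩ := inj_of (X := X) (Y := X)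
      (fun x u => (smem (spair x u) f ∧ u ≠ z) ∨ (smem (spair x z) f ∧ u = y)) (mk _)
      (fun x hx => by
        obtain ⟨u, hu⟩ := hf.1.2.2.1 x (hsub x hx)
        by_cases e : u = z
        · subst e
          refine ⟨y, hdown y (hf.1.mem hy).2 ?_, Or.inr ⟨hu, rfl⟩⟩
          rintro rfl
          exact hne x hx (hf.2 _ _ _ hu hy)
        · exact ⟨u, hdown u (hf.1.mem hu).2 e, Or.inl ⟨hu, e⟩⟩)
      (by
        rintro x u u' hx _ _ (⟨h1, h2⟩ | ⟨h1, rfl⟩) (⟨h3, h4⟩ | ⟨h3, rfl⟩)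
        · exact hf.1.2.2.2 _ _ _ h1 h3
        · exact absurd (hf.1.2.2.2 _ _ _ h1 h3) h2
        · exact absurd (hf.1.2.2.2 _ _ _ h3 h1) h4
        · rfl)
      (by
        rintro x x' u hx hx' _ (⟨h1, h2⟩ | ⟨h1, rfl⟩) (⟨h3, h4⟩ | ⟨h3, h4⟩)
        · exact hf.2 _ _ _ h1 h3
        · subst h4
          exact absurd (hf.2 _ _ _ h1 hy) (hne x hx)
        · exact absurd (hf.2 _ _ _ h3 hy) (hne x' hx')
        · exact hf.2 _ _ _ h1 h3)
    have hs := ih g hg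
    by_cases e : b = z
    · subst e
      by_cases e' : y = b
      · subst e'
        exact ⟨_, hy⟩
      · obtain ⟨x, hx⟩ := hs y (hdown y (hf.1.mem hy).2 e')
        obtain ⟨hxX, _, ⟨h1, h2⟩ | ⟨h1, _⟩⟩ := (hg2 _ _).1 hx
        · exact absurd (hf.2 _ _ _ h1 hy) (hne x hxX)
        · exact ⟨x, h1⟩
    · obtain ⟨x, hx⟩ := hs b (hdown b hb e)
      obtain ⟨hxX, _, ⟨h1, h2⟩ | ⟨h1, rfl⟩⟩ := (hg2 _ _).1 hx
      · exact ⟨x, h1⟩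
      · exact ⟨z, hy⟩

theorem no_proper {X Z x : M} (hX : FinSet X) (hZ : ∀ u, smem u Z → smem u X) (hx : smem x X)
    (hxZ : ¬ smem x Z) (h : equipollent X Z) : False := by
  obtain ⟨f, hf, _⟩ := h
  have hf' : isInjFunc f X X := by
    refine ⟨⟨hf.1.1, fun p hp => ?_, hf.1.2.2.1, hf.1.2.2.2⟩, hf.2⟩
    obtain ⟨a, b, e, ha, hb⟩ := hf.1.2.1 p hp
    exact ⟨a, b, e, ha, hZ b hb⟩
  obtain ⟨a, ha⟩ := pigeon hX hf' x hx
  exact hxZ (hf.1.mem ha).2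

theorem fin_of_nat {n : M} (hn : isNat n) : ∀ X, sset X → smem X n → FinSet X := by
  refine nat_ind (fun n => ∀ X, sset X → smem X n → FinSet X) (mk _) ?_ ?_ hn
  · intro z hz X hX hXz
    exact fin_empty ⟨hX, (hz.2 X).1 hXz⟩
  · intro a b _ ih hb X hX hXb
    obtain ⟨z, hz, d, hd, hd', hda⟩ := (hb.2 X).1 hXb
    refine fin_adj (z := z) (ih d hd hda) hX fun u => ?_
    rw [hd']
    constructor
    · intro h
      by_cases e : u = z
      · exact Or.inr e
      · exact Or.inl ⟨h, e⟩
    · rintro (h | rfl)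
      · exact h.1
      · exact hz

theorem nat_of_fin {X : M} (hX : FinSet X) : ∀ c, isCardOf c X → isNat c := by
  refine fin_ind (fun X => ∀ c, isCardOf c X → isNat c) (mk _) ?_ ?_ hX
  · intro e he c hc
    exact nat_zero (card_zero he.2 hc)
  · intro Y z Y' _ ih hz _ hm c hc
    obtain ⟨c0, hc0⟩ := exists_card Y
    refine nat_succ (ih c0 hc0) (card_succ (w := z) ((hm z).2 (Or.inr rfl)) (fun u => ?_) hc0 hc)
    rw [hm]
    constructor
    · intro h
      refine ⟨Or.inl h, ?_⟩
      rintro rfl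
      exact hz h
    · rintro ⟨h | h, h'⟩
      · exact h
      · exact absurd h h'

end Fin

section Ord
variable {M : Type} [LNFU.Structure M]

/-- `w` is reachable from `v` by finitely many steps `x ↦ ⟨x, a⟩`. -/
def le (a v w : M) : Prop :=
  ∀ B, smem v B → (∀ x, smem x B → smem (spair x a) B) → smem w B

theorem SF_le {E : Type} {Γ : Cx M E} {k : ℕ} {a v w : E → M} (h1 : TT Γ a k)
    (h2 : TT Γ v k) (h3 : TT Γ w k) : SF Γ (fun e => le (a e) (v e) (w e)) := by
  unfold le; exact strat

variable [Good M]

theorem le_refl' {a v : M} : le a v v := fun _ h _ => h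

theorem le_trans' {a u v w : M} (h1 : le a u v) (h2 : le a v w) : le a u w :=
  fun B hB hs => h2 B (h1 B hB hs) hs

theorem le_s {a v : M} : le a v (spair v a) := fun _ h hs => hs _ h

theorem le_cases {a v w : M} (h : le a v w) : v = w ∨ le a (spair v a) w := by
  obtain ⟨B, _, hB⟩ := mk (fun x => v = x ∨ le a (spair v a) x)
  refine (hB w).1 (h B ((hB v).2 (Or.inl rfl)) fun x hx => (hB _).2 (Or.inr ?_))
  rcases (hB x).1 hx with rfl | hx
  · exact le_refl'
  · exact le_trans' hx le_s

theorem le_ss {a v w : M} (h : le a (spair v a) (spair w a)) : le a v w := by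
  intro B hv hs
  obtain ⟨C, _, hC⟩ := mk (fun x => ∃ u, smem u B ∧ x = spair u a)
  obtain ⟨u, hu, e⟩ := (hC _).1 (h C ((hC _).2 ⟨v, hv, rfl⟩) (by
    intro x hx
    obtain ⟨u, hu, rfl⟩ := (hC _).1 hx
    exact (hC _).2 ⟨_, hs _ hu, rfl⟩))
  obtain ⟨rfl, _⟩ := pair_inj.1 e
  exact hu

/-- an internal copy of the natural numbers, with finite initial segments -/
structure NO (W Lt : M) : Prop where
  intro ::
  sW : sset W
  sub : ∀ v w, smem (spair v w) Lt → smem v W ∧ smem w W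
  irr : ∀ v, ¬ smem (spair v v) Lt
  tr : ∀ u v w, smem (spair u v) Lt → smem (spair v w) Lt → smem (spair u w) Lt
  tot : ∀ v w, smem v W → smem w W → v = w ∨ smem (spair v w) Lt ∨ smem (spair w v) Lt
  least : ∀ B b, smem b B → (∀ v, smem v B → smem v W) →
    ∃ m, smem m B ∧ ∀ v, smem v B → ¬ smem (spair v m) Lt
  fin : ∀ w F, smem w W → sset F → (∀ v, smem v F ↔ smem (spair v w) Lt) → FinSet F
  nxt : ∀ w, smem w W → ∃ w', smem w' W ∧ ∀ v, smem (spair v w') Lt ↔ smem (spair v w) Lt ∨ v = w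
  zero : ∃ o, smem o W ∧ ∀ v, ¬ smem (spair v o) Lt

theorem exists_NO : ∃ W Lt : M, NO W Lt := by
  obtain ⟨x0⟩ := (Good.ne : Nonempty M)
  obtain ⟨a0, _, ha0⟩ := mk (fun x : M => False)
  obtain ⟨a, _, ha⟩ := mk (fun x : M => True)
  have hne : a0 ≠ a := by
    rintro rfl
    exact (ha0 x0).1 ((ha x0).2 trivial)
  clear ha ha0
  obtain ⟨z, hz⟩ : ∃ z, z = spair a0 a0 := ⟨_, rfl⟩
  have hz0 : ∀ x, spair x a ≠ z := by
    intro x e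
    rw [hz] at e
    exact hne (pair_inj.1 e).2.symm
  obtain ⟨W, hW, hW'⟩ := mk (fun x => le a z x)
  obtain ⟨Lt, hLt, _, hLt'⟩ := mkRel
    (fun v w => le a z v ∧ le a z w ∧ le a (spair v a) w) (mk _)
  have hnz : ∀ x, ¬ le a (spair x a) z := by
    intro x h
    obtain ⟨B, _, hB⟩ := mk (fun x => x ≠ z)
    exact (hB z).1 (h B ((hB _).2 (hz0 x)) (fun y _ => (hB _).2 (hz0 y))) rfl
  have hirr : ∀ w, le a z w → ¬ le a (spair w a) w := by
    intro w hw
    obtain ⟨B, _, hB⟩ := mk (fun w => ¬ le a (spair w a) w)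
    refine (hB w).1 (hw B ((hB z).2 (hnz z)) fun x hx => (hB _).2 fun h => (hB x).1 hx (le_ss h))
  have htot : ∀ v w, le a z v → le a z w → le a v w ∨ le a w v := by
    intro v w hv hw
    obtain ⟨B, _, hB⟩ := mk (fun w => le a v w ∨ le a w v)
    refine (hB w).1 (hw B ((hB z).2 (Or.inr hv)) fun x hx => (hB _).2 ?_)
    rcases (hB x).1 hx with h | h
    · exact Or.inl (le_trans' h le_s)
    · rcases le_cases h with rfl | h
      · exact Or.inl le_s
      · exact Or.inr h
  have hlt_s : ∀ v w, le a z w → (smem (spair v (spair w a)) Lt ↔ smem (spair v w) Lt ∨ v = w) := by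
    intro v w hw
    rw [hLt', hLt']
    constructor
    · rintro ⟨h1, h2, h3⟩
      rcases le_cases (le_ss h3) with rfl | h4
      · exact Or.inr rfl
      · exact Or.inl ⟨h1, hw, h4⟩
    · rintro (⟨h1, h2, h3⟩ | rfl)
      · exact ⟨h1, le_trans' h2 le_s, le_trans' h3 le_s⟩
      · exact ⟨hw, le_trans' hw le_s, le_refl'⟩
  have hltz : ∀ v, ¬ smem (spair v z) Lt := fun v h => hnz v ((hLt' _ _).1 h).2.2
  refine ⟨W, Lt, hW, ?_, ?_, ?_, ?_, ?_, ?_, ?_, ⟨z, (hW' z).2 le_refl', hltz⟩⟩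
  · intro v w h
    have := (hLt' _ _).1 h
    exact ⟨(hW' _).2 this.1, (hW' _).2 this.2.1⟩
  · intro v h
    have := (hLt' _ _).1 h
    exact hirr v this.1 this.2.2
  · intro u v w h1 h2
    rw [hLt'] at *
    exact ⟨h1.1, h2.2.1, le_trans' h1.2.2 (le_trans' le_s h2.2.2)⟩
  · intro v w hv hw
    rw [hW'] at hv hw
    rcases htot v w hv hw with h | h
    · rcases le_cases h with h | h
      · exact Or.inl h
      · exact Or.inr (Or.inl ((hLt' _ _).2 ⟨hv, hw, h⟩))
    · rcases le_cases h with h | h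
      · exact Or.inl h.symm
      · exact Or.inr (Or.inr ((hLt' _ _).2 ⟨hw, hv, h⟩))
  · intro B b hb hBW
    by_contra hcon
    push Not at hcon
    obtain ⟨C, _, hC⟩ := mk (fun w => le a z w ∧ ∀ v, smem (spair v w) Lt → ¬ smem v B)
    have hall : smem b C := by
      refine ((hW' b).1 (hBW b hb)) C ((hC z).2 ⟨le_refl', fun v h => absurd h (hltz v)⟩) ?_
      intro x hx
      obtain ⟨hxW, hx⟩ := (hC x).1 hx
      refine (hC _).2 ⟨le_trans' hxW le_s, fun v hv hvB => ?_⟩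
      rcases (hlt_s v x hxW).1 hv with h | rfl
      · exact hx v h hvB
      · obtain ⟨u, huB, hu⟩ := hcon v hvB
        exact hx u hu huB
    obtain ⟨u, huB, hu⟩ := hcon b hb
    exact ((hC b).1 hall).2 u hu huB
  · intro w F hw hF hF'
    obtain ⟨C, _, hC⟩ := mk (fun w => le a z w ∧ ∀ F, sset F → (∀ v, smem v F ↔ smem (spair v w) Lt) → FinSet F)
    refine ((hC w).1 ((hW' w).1 hw C ((hC z).2 ⟨le_refl', ?_⟩) ?_)).2 F hF hF'
    · intro F hF h
      exact fin_empty ⟨hF, fun v hv => hltz v ((h v).1 hv)⟩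
    · intro x hx
      obtain ⟨hxW, hx⟩ := (hC x).1 hx
      refine (hC _).2 ⟨le_trans' hxW le_s, fun F hF h => ?_⟩
      obtain ⟨G, hG, hG'⟩ := mk (fun v => smem (spair v x) Lt)
      refine fin_adj (z := x) (hx G hG hG') hF fun u => ?_
      rw [h, hG', hlt_s u x hxW]
  · intro w hw
    rw [hW'] at hw
    exact ⟨spair w a, (hW' _).2 (le_trans' hw le_s), fun v => hlt_s v w hw⟩

end Ord

section Seg
variable {M : Type} [LNFU.Structure M]

/-- `F` is the set of `Lt`-predecessors of `w`. -/
def isF (Lt F w : M) : Prop := sset F ∧ ∀ v, smem v F ↔ smem (spair v w) Lt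

theorem SF_isF {E : Type} {Γ : Cx M E} {k : ℕ} {Lt F w : E → M} (h1 : TT Γ Lt (k + 1))
    (h2 : TT Γ F (k + 1)) (h3 : TT Γ w k) : SF Γ (fun e => isF (Lt e) (F e) (w e)) := by
  unfold isF; exact strat

/-- a linear order with finite initial segments -/
structure FO (W Lt : M) : Prop where
  intro ::
  sub : ∀ v w, smem (spair v w) Lt → smem v W ∧ smem w W
  irr : ∀ v, ¬ smem (spair v v) Lt
  tr : ∀ u v w, smem (spair u v) Lt → smem (spair v w) Lt → smem (spair u w) Lt
  tot : ∀ v w, smem v W → smem w W → v = w ∨ smem (spair v w) Lt ∨ smem (spair w v) Lt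
  fin : ∀ w F, smem w W → isF Lt F w → FinSet F

theorem NO.fo {W Lt : M} [Good M] (h : NO W Lt) : FO W Lt :=
  ⟨h.sub, h.irr, h.tr, h.tot, fun w F hw hF => h.fin w F hw hF.1 hF.2⟩

variable [Good M] {W Lt : M}

theorem exists_F (Lt w : M) : ∃ F, isF Lt F w := mk _

theorem FO.no_lt (h : FO W Lt) {v w F G : M} (hF : isF Lt F v) (hG : isF Lt G w)
    (e : equipollent F G) : ¬ smem (spair v w) Lt := by
  intro hvw
  refine no_proper (X := G) (Z := F) (x := v) (h.fin w G (h.sub _ _ hvw).2 hG) ?_ ?_ ?_ (eqp_symm e)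
  · intro u hu
    exact (hG.2 u).2 (h.tr _ _ _ ((hF.2 u).1 hu) hvw)
  · exact (hG.2 v).2 hvw
  · exact fun hv => h.irr v ((hF.2 v).1 hv)

theorem FO.seg_inj (h : FO W Lt) {v w F G : M} (hv : smem v W) (hw : smem w W)
    (hF : isF Lt F v) (hG : isF Lt G w) (e : equipollent F G) : v = w := by
  rcases h.tot v w hv hw with h1 | h1 | h1
  · exact h1
  · exact absurd h1 (h.no_lt hF hG e)
  · exact absurd h1 (h.no_lt hG hF (eqp_symm e))

theorem NO.nxt_inj (h : NO W Lt) {v w u : M}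
    (hv : ∀ x, smem (spair x u) Lt ↔ smem (spair x v) Lt ∨ x = v)
    (hw : ∀ x, smem (spair x u) Lt ↔ smem (spair x w) Lt ∨ x = w) : v = w := by
  rcases (hw v).1 ((hv v).2 (Or.inr rfl)) with h1 | h1
  · rcases (hv w).1 ((hw w).2 (Or.inr rfl)) with h2 | h2
    · exact absurd (h.tr _ _ _ h1 h2) (h.irr _)
    · exact h2.symm
  · exact h1

theorem NO.fin_cnt0 (h : NO W Lt) {X : M} (hX : FinSet X) :
    ∃ v F, smem v W ∧ isF Lt F v ∧ equipollent X F := by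
  refine fin_ind (fun X => ∃ v F, smem v W ∧ isF Lt F v ∧ equipollent X F) (mk _) ?_ ?_ hX
  · intro e he
    obtain ⟨o, ho, ho'⟩ := h.zero
    obtain ⟨F, hF⟩ := exists_F Lt o
    refine ⟨o, F, ho, hF, eqp_of_same fun u => ?_⟩
    rw [hF.2]
    exact ⟨fun h => absurd h (he.2 u), fun h => absurd h (ho' u)⟩
  · rintro Y z Y' _ ⟨v, F, hv, hF, e⟩ hz _ hm
    obtain ⟨v', hv', hv2⟩ := h.nxt v hv
    obtain ⟨F', hF'⟩ := exists_F Lt v'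
    refine ⟨v', F', hv', hF', eqp_adj (x := z) (y := v) ?_ ?_ ?_ ?_ e⟩
    · intro u
      rw [hm]
      constructor
      · intro hu
        exact ⟨Or.inl hu, fun e => hz (e ▸ hu)⟩
      · rintro ⟨h1 | h1, h2⟩
        · exact h1
        · exact absurd h1 h2
    · exact (hm z).2 (Or.inr rfl)
    · intro u
      rw [hF'.2, hF.2, hv2]
      constructor
      · intro hu
        exact ⟨Or.inl hu, fun e => h.irr v (e ▸ hu)⟩
      · rintro ⟨h1 | h1, h2⟩
        · exact h1
        · exact absurd h1 h2
    · rw [hF'.2, hv2]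
      exact Or.inr rfl

theorem NO.fin_count (h : NO W Lt) {X : M} (hX : FinSet X) :
    ∃ v F I, smem v W ∧ isF Lt F v ∧ isIotaImageOf I F ∧ equipollent I X := by
  refine fin_ind (fun X => ∃ v F I, smem v W ∧ isF Lt F v ∧ isIotaImageOf I F ∧ equipollent I X)
    (mk _) ?_ ?_ hX
  · intro e he
    obtain ⟨o, ho, ho'⟩ := h.zero
    obtain ⟨F, hF⟩ := exists_F Lt o
    obtain ⟨I, hI⟩ := exists_iota F
    refine ⟨o, F, I, ho, hF, hI, eqp_of_same fun u => ?_⟩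
    rw [hI.2]
    constructor
    · rintro ⟨x, hx, _⟩
      exact absurd ((hF.2 x).1 hx) (ho' x)
    · exact fun h => absurd h (he.2 u)
  · rintro Y z Y' _ ⟨v, F, I, hv, hF, hI, e⟩ hz _ hm
    obtain ⟨v', hv', hv2⟩ := h.nxt v hv
    obtain ⟨F', hF'⟩ := exists_F Lt v'
    obtain ⟨I', hI'⟩ := exists_iota F'
    obtain ⟨sv, hsv⟩ := exists_single v
    refine ⟨v', F', I', hv', hF', hI', eqp_adj (x := sv) (y := z) ?_ ?_ ?_ ?_ e⟩
    · intro u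
      rw [hI.2, hI'.2]
      constructor
      · rintro ⟨x, hx, hxu⟩
        rw [hF.2] at hx
        refine ⟨⟨x, (hF'.2 x).2 ((hv2 x).2 (Or.inl hx)), hxu⟩, ?_⟩
        rintro rfl
        obtain rfl := single_inj hxu hsv
        exact h.irr _ hx
      · rintro ⟨⟨x, hx, hxu⟩, hne⟩
        rw [hF'.2, hv2] at hx
        rcases hx with hx | rfl
        · exact ⟨x, (hF.2 x).2 hx, hxu⟩
        · exact absurd (single_unique hxu hsv) hne
    · exact (hI'.2 sv).2 ⟨v, (hF'.2 v).2 ((hv2 v).2 (Or.inr rfl)), hsv⟩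
    · intro u
      rw [hm]
      constructor
      · intro hu
        exact ⟨Or.inl hu, fun e => hz (e ▸ hu)⟩
      · rintro ⟨h1 | h1, h2⟩
        · exact h1
        · exact absurd h1 h2
    · exact (hm z).2 (Or.inr rfl)

/-- all members of the set `A` are pairs of elements below `n` -/
def bd (Lt A n : M) : Prop := sset A ∧ ∀ p, smem p A →
  ∃ i j, p = spair i j ∧ smem (spair i n) Lt ∧ smem (spair j n) Lt

theorem SF_bd {E : Type} {Γ : Cx M E} {k : ℕ} {Lt A n : E → M} (h1 : TT Γ Lt (k + 1))
    (h2 : TT Γ A (k + 1)) (h3 : TT Γ n k) : SF Γ (fun e => bd (Lt e) (A e) (n e)) := by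
  unfold bd; exact strat

def Dd (W Lt A B : M) : Prop := ∃ n, smem n W ∧ bd Lt A n ∧ ¬ bd Lt B n

theorem SF_Dd {E : Type} {Γ : Cx M E} {k : ℕ} {W Lt A B : E → M} (h0 : TT Γ W (k + 1))
    (h1 : TT Γ Lt (k + 1)) (h2 : TT Γ A (k + 1)) (h3 : TT Γ B (k + 1)) :
    SF Γ (fun e => Dd (W e) (Lt e) (A e) (B e)) := by
  unfold Dd; exact strat

def lexx (Lt A B : M) : Prop := ∃ i j, smem (spair i j) B ∧ ¬ smem (spair i j) A ∧
  ∀ k l, (smem (spair k i) Lt ∨ (k = i ∧ smem (spair l j) Lt)) →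
    (smem (spair k l) A ↔ smem (spair k l) B)

theorem SF_lexx {E : Type} {Γ : Cx M E} {k : ℕ} {Lt A B : E → M}
    (h1 : TT Γ Lt (k + 1)) (h2 : TT Γ A (k + 1)) (h3 : TT Γ B (k + 1)) :
    SF Γ (fun e => lexx (Lt e) (A e) (B e)) := by
  unfold lexx; exact strat

theorem bd_mem {A n i j : M} (h : bd Lt A n) (hp : smem (spair i j) A) :
    smem (spair i n) Lt ∧ smem (spair j n) Lt := by
  obtain ⟨i', j', e, h1, h2⟩ := h.2 _ hp
  obtain ⟨rfl, rfl⟩ := pair_inj.1 e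
  exact ⟨h1, h2⟩

theorem NO.bd_mono (h : NO W Lt) {A n m : M} (hA : bd Lt A n) (hn : smem (spair n m) Lt) :
    bd Lt A m := by
  refine ⟨hA.1, fun p hp => ?_⟩
  obtain ⟨i, j, e, h1, h2⟩ := hA.2 p hp
  exact ⟨i, j, e, h.tr _ _ _ h1 hn, h.tr _ _ _ h2 hn⟩

theorem NO.lexx_tot (h : NO W Lt) {A B n m : M} (hA : bd Lt A n) (hB : bd Lt B m) :
    A = B ∨ lexx Lt A B ∨ lexx Lt B A := by
  by_cases hne : ∃ i j, ¬ (smem (spair i j) A ↔ smem (spair i j) B)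
  · right
    have hW : ∀ i j, ¬ (smem (spair i j) A ↔ smem (spair i j) B) → smem i W ∧ smem j W := by
      intro i j hij
      by_cases h1 : smem (spair i j) A
      · have := bd_mem hA h1
        exact ⟨(h.sub _ _ this.1).1, (h.sub _ _ this.2).1⟩
      · have := bd_mem hB (i := i) (j := j) (by tauto)
        exact ⟨(h.sub _ _ this.1).1, (h.sub _ _ this.2).1⟩
    obtain ⟨i, j, hij⟩ := hne
    obtain ⟨C, _, hC⟩ := mk (fun i => ∃ j, ¬ (smem (spair i j) A ↔ smem (spair i j) B))
    obtain ⟨i, hi, hi'⟩ := h.least C i ((hC i).2 ⟨j, hij⟩) (by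
      intro v hv
      obtain ⟨j, hj⟩ := (hC v).1 hv
      exact (hW _ _ hj).1)
    obtain ⟨j, hij⟩ := (hC i).1 hi
    obtain ⟨D, _, hD⟩ := mk (fun j => ¬ (smem (spair i j) A ↔ smem (spair i j) B))
    obtain ⟨j, hj, hj'⟩ := h.least D j ((hD j).2 hij) (by
      intro v hv
      exact (hW _ _ ((hD v).1 hv)).2)
    have hij := (hD j).1 hj
    have key : ∀ k l, (smem (spair k i) Lt ∨ (k = i ∧ smem (spair l j) Lt)) →
        (smem (spair k l) A ↔ smem (spair k l) B) := by
      rintro k l (hk | ⟨rfl, hl⟩)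
      · by_contra hcon
        exact hi' k ((hC k).2 ⟨l, hcon⟩) hk
      · by_contra hcon
        exact hj' l ((hD l).2 hcon) hl
    by_cases h1 : smem (spair i j) A
    · exact Or.inr ⟨i, j, h1, by tauto, fun k l hkl => (key k l hkl).symm⟩
    · exact Or.inl ⟨i, j, by tauto, h1, key⟩
  · left
    push Not at hne
    refine Good.ext hA.1 hB.1 fun p => ?_
    constructor
    · intro hp
      obtain ⟨i, j, rfl, _⟩ := hA.2 p hp
      exact (hne i j).1 hp
    · intro hp
      obtain ⟨i, j, rfl, _⟩ := hB.2 p hp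
      exact (hne i j).2 hp

theorem NO.lexx_trans (h : NO W Lt) {A B C n m : M} (hB : bd Lt B n) (hC : bd Lt C m)
    (h1 : lexx Lt A B) (h2 : lexx Lt B C) : lexx Lt A C := by
  obtain ⟨i, j, hb, ha, hk⟩ := h1
  obtain ⟨i', j', hc, hb', hk'⟩ := h2
  have m1 := bd_mem hB hb
  have m2 := bd_mem hC hc
  have lt : ∀ x y z, smem (spair x y) Lt → smem (spair y z) Lt → smem (spair x z) Lt := h.tr
  rcases h.tot i i' (h.sub _ _ m1.1).1 (h.sub _ _ m2.1).1 with rfl | hi | hi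
  · rcases h.tot j j' (h.sub _ _ m1.2).1 (h.sub _ _ m2.2).1 with rfl | hj | hj
    · exact absurd hb hb'
    · refine ⟨i, j, (hk' _ _ (Or.inr ⟨rfl, hj⟩)).1 hb, ha, fun k l hkl => ?_⟩
      refine (hk k l hkl).trans (hk' k l ?_)
      rcases hkl with h3 | ⟨rfl, h3⟩
      · exact Or.inl h3
      · exact Or.inr ⟨rfl, lt _ _ _ h3 hj⟩
    · refine ⟨i, j', hc, fun hh => hb' ((hk _ _ (Or.inr ⟨rfl, hj⟩)).1 hh), fun k l hkl => ?_⟩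
      refine (hk k l ?_).trans (hk' k l hkl)
      rcases hkl with h3 | ⟨rfl, h3⟩
      · exact Or.inl h3
      · exact Or.inr ⟨rfl, lt _ _ _ h3 hj⟩
  · refine ⟨i, j, (hk' _ _ (Or.inl hi)).1 hb, ha, fun k l hkl => ?_⟩
    refine (hk k l hkl).trans (hk' k l (Or.inl ?_))
    rcases hkl with h3 | ⟨rfl, h3⟩
    · exact lt _ _ _ h3 hi
    · exact hi
  · refine ⟨i', j', hc, fun hh => hb' ((hk _ _ (Or.inl hi)).1 hh), fun k l hkl => ?_⟩
    refine (hk k l (Or.inl ?_)).trans (hk' k l hkl)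
    rcases hkl with h3 | ⟨rfl, h3⟩
    · exact lt _ _ _ h3 hi
    · exact hi

theorem NO.Dd_lin (h : NO W Lt) {A B : M} (h1 : Dd W Lt A B) : ¬ Dd W Lt B A := by
  rintro ⟨m, hm, hB, hA⟩
  obtain ⟨n, hn, hA', hB'⟩ := h1
  rcases h.tot n m hn hm with rfl | h2 | h2
  · exact hA hA'
  · exact hA (h.bd_mono hA' h2)
  · exact hB' (h.bd_mono hB h2)

theorem exists_L (h : NO W Lt) : ∃ L Pr : M, FO L Pr ∧
    ∀ A, smem A L ↔ ∃ n, smem n W ∧ bd Lt A n := by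
  obtain ⟨L, hL, hL'⟩ := mk (fun A => ∃ n, smem n W ∧ bd Lt A n)
  obtain ⟨Pr, hPr, _, hPr'⟩ := mkRel (fun A B => smem A L ∧ smem B L ∧
    (Dd W Lt A B ∨ (¬ Dd W Lt B A ∧ lexx Lt A B))) (mk _)
  have split : ∀ A B C, Dd W Lt A C → Dd W Lt A B ∨ Dd W Lt B C := by
    rintro A B C ⟨n, hn, hA, hC⟩
    by_cases hB : bd Lt B n
    · exact Or.inr ⟨n, hn, hB, hC⟩
    · exact Or.inl ⟨n, hn, hA, hB⟩
  have dtr : ∀ A B C, Dd W Lt A B → ¬ Dd W Lt C B → Dd W Lt A C := by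
    intro A B C h1 h2
    exact (split A C B h1).resolve_right h2
  have dtr' : ∀ A B C, ¬ Dd W Lt B A → Dd W Lt B C → Dd W Lt A C := by
    intro A B C h1 h2
    exact (split B A C h2).resolve_left h1
  refine ⟨L, Pr, ⟨?_, ?_, ?_, ?_, ?_⟩, hL'⟩
  · intro A B hAB
    have := (hPr' _ _).1 hAB
    exact ⟨this.1, this.2.1⟩
  · intro A hA
    obtain ⟨_, _, h1 | ⟨_, i, j, h1, h2, _⟩⟩ := (hPr' _ _).1 hA
    · exact h.Dd_lin h1 h1
    · exact h2 h1
  · intro A B C h1 h2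
    obtain ⟨hA, hB, h1⟩ := (hPr' _ _).1 h1
    obtain ⟨_, hC, h2⟩ := (hPr' _ _).1 h2
    refine (hPr' _ _).2 ⟨hA, hC, ?_⟩
    rcases h1 with h1 | ⟨h1, l1⟩
    · rcases h2 with h2 | ⟨h2, l2⟩
      · exact Or.inl (dtr A B C h1 (h.Dd_lin h2))
      · exact Or.inl (dtr A B C h1 h2)
    · rcases h2 with h2 | ⟨h2, l2⟩
      · exact Or.inl (dtr' A B C h1 h2)
      · obtain ⟨n, _, hBn⟩ := (hL' B).1 hB
        obtain ⟨m, _, hCm⟩ := (hL' C).1 hC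
        refine Or.inr ⟨fun hd => ?_, h.lexx_trans hBn hCm l1 l2⟩
        rcases split C B A hd with h3 | h3
        · exact h2 h3
        · exact h1 h3
  · intro A B hA hB
    obtain ⟨n, _, hAn⟩ := (hL' A).1 hA
    obtain ⟨m, _, hBm⟩ := (hL' B).1 hB
    rw [hPr', hPr']
    by_cases d1 : Dd W Lt A B
    · exact Or.inr (Or.inl ⟨hA, hB, Or.inl d1⟩)
    by_cases d2 : Dd W Lt B A
    · exact Or.inr (Or.inr ⟨hB, hA, Or.inl d2⟩)
    rcases h.lexx_tot hAn hBm with e | l | l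
    · exact Or.inl e
    · exact Or.inr (Or.inl ⟨hA, hB, Or.inr ⟨d2, l⟩⟩)
    · exact Or.inr (Or.inr ⟨hB, hA, Or.inr ⟨d1, l⟩⟩)
  · intro A sg hA hsg
    obtain ⟨n, hn, hAn⟩ := (hL' A).1 hA
    obtain ⟨F, hF⟩ := exists_F Lt n
    have hFf := h.fo.fin n F hn hF
    obtain ⟨P, hP⟩ : ∃ P, isProdOf P F F := mk _
    obtain ⟨Q, hQ⟩ : ∃ Q, isPowerSetOf Q P := mk _
    refine fin_subset (fin_power (fin_prod hFf hFf hP) hQ) hsg.1 fun B hB => ?_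
    obtain ⟨_, _, hBA⟩ := (hPr' _ _).1 ((hsg.2 B).1 hB)
    have hBn : bd Lt B n := by
      by_contra hcon
      have hd : Dd W Lt A B := ⟨n, hn, hAn, hcon⟩
      rcases hBA with h1 | ⟨h1, _⟩
      · exact h.Dd_lin h1 hd
      · exact h1 hd
    refine (hQ.2 B).2 ⟨hBn.1, fun p hp => ?_⟩
    obtain ⟨i, j, rfl, h1, h2⟩ := hBn.2 p hp
    exact (hP.2 _).2 ⟨i, j, (hF.2 i).2 h1, (hF.2 j).2 h2, rfl⟩

end Seg

section Base
variable {M : Type} [LNFU.Structure M] [Good M]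

def code (W Lt L Pr a v : M) : Prop := smem v W ∧ ∃ A F I sg, smem A a ∧ smem A L ∧ isF Lt F v ∧
  isIotaImageOf I F ∧ isF Pr sg A ∧ equipollent I sg

theorem SF_code {E : Type} {Γ : Cx M E} {k : ℕ} {W Lt L Pr a v : E → M} (h1 : TT Γ W (k + 1))
    (h2 : TT Γ Lt (k + 1)) (h3 : TT Γ L (k + 2)) (h4 : TT Γ Pr (k + 2)) (h5 : TT Γ a (k + 2))
    (h6 : TT Γ v k) : SF Γ (fun e => code (W e) (Lt e) (L e) (Pr e) (a e) (v e)) := by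
  unfold code; exact strat

theorem exists_rep {W Lt R D c : M} (h : NO W Lt) (hR : isRel R) (hD : isFieldSetOf D R)
    (hc : isCardOf c D) (hn : isNat c) : ∃ A n, smem n W ∧ bd Lt A n ∧ relIso A R := by
  have hDf : FinSet D := fin_of_nat hn D hD.1 ((hc.2 D).2 (eqp_refl D))
  obtain ⟨n, F, hnW, hF, f, hf, hfs⟩ := h.fin_cnt0 hDf
  obtain ⟨A, hA, hA1, hA2⟩ := mkRel (fun i j => ∃ x y, smem (spair x y) R ∧ smem (spair x i) f ∧
    smem (spair y j) f) (mk _)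
  have fieldA : ∀ x i, smem (spair x i) f → inField i A := by
    intro x i hxi
    obtain ⟨y, hy | hy⟩ := (hD.2 x).1 (hf.1.mem hxi).1
    · obtain ⟨j, hj⟩ := hf.1.2.2.1 y ((hD.2 y).2 ⟨x, Or.inr hy⟩)
      exact ⟨j, Or.inl ((hA2 _ _).2 ⟨x, y, hy, hxi, hj⟩)⟩
    · obtain ⟨j, hj⟩ := hf.1.2.2.1 y ((hD.2 y).2 ⟨x, Or.inl hy⟩)
      exact ⟨j, Or.inr ((hA2 _ _).2 ⟨y, x, hy, hj, hxi⟩)⟩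
  refine ⟨A, n, hnW, ⟨hA, fun p hp => ?_⟩, iso_symm ⟨f, hf.1.1, ?_, ?_, hf.1.2.2.2, hf.2, ?_, ?_⟩⟩
  · obtain ⟨i, j, e, x, y, _, hx, hy⟩ := hA1 p hp
    exact ⟨i, j, e, (hF.2 i).1 (hf.1.mem hx).2, (hF.2 j).1 (hf.1.mem hy).2⟩
  · intro p hp
    obtain ⟨x, i, rfl, hx, hi⟩ := hf.1.2.1 p hp
    exact ⟨x, i, rfl, (hD.2 x).1 hx, fieldA x i hp⟩
  · intro x hx
    exact hf.1.2.2.1 x ((hD.2 x).2 hx)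
  · rintro i ⟨j, hj | hj⟩
    · obtain ⟨x, y, _, hx, _⟩ := (hA2 _ _).1 hj
      exact ⟨x, hx⟩
    · obtain ⟨x, y, _, _, hy⟩ := (hA2 _ _).1 hj
      exact ⟨y, hy⟩
  · intro x y i j hx hy
    rw [hA2]
    constructor
    · intro hxy
      exact ⟨x, y, hxy, hx, hy⟩
    · rintro ⟨x', y', hxy, hx', hy'⟩
      obtain rfl := hf.2 _ _ _ hx hx'
      obtain rfl := hf.2 _ _ _ hy hy'
      exact hxy

/-- a code for a BF: least code, shifted by two. -/
theorem base (y N c : M) (hy : isM0Set y) (hN : isNatSet N) (hc : isCardOf c N) : Cl y c := by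
  obtain ⟨W, Lt, h⟩ := exists_NO (M := M)
  obtain ⟨L, Pr, hFO, hL⟩ := exists_L h
  have hcode : ∀ a, smem a y → ∃ v, code W Lt L Pr a v := by
    intro a ha
    obtain ⟨⟨S, hS, haS⟩, R, D, d, hRa, hD, hd, hdn⟩ := (hy.2 a).1 ha
    -- the relation part of `R`
    obtain ⟨R', hR', hR1, hR2⟩ := mkRel (fun u v => smem (spair u v) R) (mk _)
    have hf : ∀ x, inField x R' ↔ inField x R := by
      intro x
      unfold inField
      simp only [hR2]
    have hD' : isFieldSetOf D R' := ⟨hD.1, fun x => (hD.2 x).trans (hf x).symm⟩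
    have hRR : relIso R' R := by
      obtain ⟨f, hf0⟩ := iso_refl R
      refine ⟨f, hf0.1, ?_, ?_, hf0.2.2.2.1, hf0.2.2.2.2.1, hf0.2.2.2.2.2.1, ?_⟩
      · simpa only [hf] using hf0.2.1
      · simpa only [hf] using hf0.2.2.1
      · simpa only [hR2] using hf0.2.2.2.2.2.2
    obtain ⟨A, n, hn, hAn, hA⟩ := exists_rep h ⟨hR', fun p hp => by
      obtain ⟨u, v, e, _⟩ := hR1 p hp
      exact ⟨u, v, e⟩⟩ hD' hd hdn
    have hAL : smem A L := (hL A).2 ⟨n, hn, hAn⟩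
    have hAa : smem A a := (haS.2 A).2 (iso_trans hA (iso_trans hRR ((haS.2 R).1 hRa)))
    obtain ⟨sg, hsg⟩ := exists_F Pr A
    obtain ⟨v, F, I, hv, hF, hI, e⟩ := h.fin_count (hFO.fin A sg hAL hsg)
    exact ⟨v, hv, A, F, I, sg, hAa, hAL, hF, hI, hsg, e⟩
  have hcinj : ∀ a a' v, smem a y → smem a' y → code W Lt L Pr a v → code W Lt L Pr a' v →
      a = a' := by
    rintro a a' v ha ha' ⟨hv, A, F, I, sg, hAa, hAL, hF, hI, hsg, e⟩
      ⟨_, A', F', I', sg', hAa', hAL', hF', hI', hsg', e'⟩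
    obtain rfl : F = F' := Good.ext hF.1 hF'.1 fun u => (hF.2 u).trans (hF'.2 u).symm
    obtain rfl : I = I' := Good.ext hI.1 hI'.1 fun u => (hI.2 u).trans (hI'.2 u).symm
    obtain rfl : A = A' := hFO.seg_inj hAL hAL' hsg hsg' (eqp_trans (eqp_symm e) e')
    obtain ⟨⟨S, hS, haS⟩, _⟩ := (hy.2 a).1 ha
    obtain ⟨⟨S', hS', haS'⟩, _⟩ := (hy.2 a').1 ha'
    have i1 := (haS.2 A).1 hAa
    have i2 := (haS'.2 A).1 hAa'
    refine Good.ext haS.1 haS'.1 fun U => ?_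
    rw [haS.2, haS'.2]
    exact ⟨fun hU => iso_trans hU (iso_trans (iso_symm i1) i2),
      fun hU => iso_trans hU (iso_trans (iso_symm i2) i1)⟩
  have huniq : ∀ u u', smem u W → smem u' W → (∀ x, smem (spair x u) Lt ↔ smem (spair x u') Lt) →
      u = u' := by
    intro u u' hu hu' hx
    rcases h.tot u u' hu hu' with h1 | h1 | h1
    · exact h1
    · exact absurd ((hx u).2 h1) (h.irr u)
    · exact absurd ((hx u').1 h1) (h.irr u')
  have hnatF : ∀ u F n, smem u W → isF Lt F u → isCardOf n F → smem n N := by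
    intro u F n hu hF hn
    exact (hN.2 n).2 (nat_of_fin (h.fo.fin u F hu hF) n hn)
  have hcardF : ∀ u u' F F' n, smem u W → smem u' W → isF Lt F u → isF Lt F' u' →
      isCardOf n F → isCardOf n F' → u = u' := by
    intro u u' F F' n hu hu' hF hF' hn hn'
    exact h.fo.seg_inj hu hu' hF hF' ((hn'.2 F).1 ((hn.2 F).2 (eqp_refl F)))
  obtain ⟨f, hf, hf2⟩ := inj_of (X := y) (Y := N) (fun a n => ∃ v u u' F, code W Lt L Pr a v ∧
      (∀ v', code W Lt L Pr a v' → ¬ smem (spair v' v) Lt) ∧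
      smem u W ∧ (∀ x, smem (spair x u) Lt ↔ smem (spair x v) Lt ∨ x = v) ∧
      smem u' W ∧ (∀ x, smem (spair x u') Lt ↔ smem (spair x u) Lt ∨ x = u) ∧
      isF Lt F u' ∧ isCardOf n F) (mk _)
    (by
      intro a ha
      obtain ⟨v0, hv0⟩ := hcode a ha
      obtain ⟨B, _, hB⟩ := mk (fun v => code W Lt L Pr a v)
      obtain ⟨v, hv, hvm⟩ := h.least B v0 ((hB v0).2 hv0) (fun v hv => ((hB v).1 hv).1)
      rw [hB] at hv
      obtain ⟨u, hu, hu2⟩ := h.nxt v hv.1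
      obtain ⟨u', hu', hu2'⟩ := h.nxt u hu
      obtain ⟨F, hF⟩ := exists_F Lt u'
      obtain ⟨n, hn⟩ := exists_card F
      exact ⟨n, hnatF u' F n hu' hF hn, v, u, u', F, hv, fun v' hv' => hvm v' ((hB v').2 hv'),
        hu, hu2, hu', hu2', hF, hn⟩)
    (by
      rintro a n n' ha _ _ ⟨v, u, u', F, hv, hvm, hu, hu2, hu', hu2', hF, hn⟩
        ⟨v1, u1, u1', F1, hv1, hvm1, hu1, hu21, hu1', hu21', hF1, hn1⟩
      have e1 : v = v1 := by
        rcases h.tot v v1 hv.1 hv1.1 with e | e | e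
        · exact e
        · exact absurd e (hvm1 v hv)
        · exact absurd e (hvm v1 hv1)
      subst e1
      obtain rfl := huniq u u1 hu hu1 fun x => (hu2 x).trans (hu21 x).symm
      obtain rfl := huniq u' u1' hu' hu1' fun x => (hu2' x).trans (hu21' x).symm
      obtain rfl : F = F1 := Good.ext hF.1 hF1.1 fun u => (hF.2 u).trans (hF1.2 u).symm
      exact card_unique hn hn1)
    (by
      rintro a a' n ha ha' _ ⟨v, u, u', F, hv, hvm, hu, hu2, hu', hu2', hF, hn⟩
        ⟨v1, u1, u1', F1, hv1, hvm1, hu1, hu21, hu1', hu21', hF1, hn1⟩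
      obtain rfl := hcardF u' u1' F F1 n hu' hu1' hF hF1 hn hn1
      obtain rfl := h.nxt_inj hu2' hu21'
      obtain rfl := h.nxt_inj hu2 hu21
      exact hcinj a a' v ha ha' hv hv1)
  obtain ⟨o, ho, ho2⟩ := h.zero
  obtain ⟨p, hp, hp2⟩ := h.nxt o ho
  obtain ⟨Fo, hFo⟩ := exists_F Lt o
  obtain ⟨Fp, hFp⟩ := exists_F Lt p
  obtain ⟨y0, hy0⟩ := exists_card Fo
  obtain ⟨y1, hy1⟩ := exists_card Fp
  refine ⟨N, f, y0, y1, (hc.2 N).2 (eqp_refl N), hf, hnatF o Fo y0 ho hFo hy0,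
    hnatF p Fp y1 hp hFp hy1, ?_, fun x => ⟨fun hx => ?_, fun hx => ?_⟩⟩
  · rintro rfl
    obtain rfl := hcardF o p Fo Fp y0 ho hp hFo hFp hy0 hy1
    exact ho2 o ((hp2 o).2 (Or.inr rfl))
  · obtain ⟨_, _, v, u, u', F, hv, hvm, hu, hu2, hu', hu2', hF, hn⟩ := (hf2 _ _).1 hx
    obtain rfl := hcardF u' o F Fo y0 hu' ho hF hFo hn hy0
    exact ho2 u ((hu2' u).2 (Or.inr rfl))
  · obtain ⟨_, _, v, u, u', F, hv, hvm, hu, hu2, hu', hu2', hF, hn⟩ := (hf2 _ _).1 hx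
    obtain rfl := hcardF u' p F Fp y1 hu' hp hF hFp hn hy1
    obtain rfl := h.nxt_inj hu2' hp2
    exact ho2 v ((hu2 v).2 (Or.inr rfl))

end Base

theorem stmt15 :
    ∀ (M : Type) [LNFU.Structure M] [Nonempty M], M ⊨ NFUmAC →
      ∀ g f : M, isMFun g → isBethFun f →
        ∀ n t b mn c : M, isNat n → isTOf t n → smem (spair t b) f → ¬ isEmptySet b →
          smem (spair n mn) g → isCardOf c mn → cardLe c b := by
  intro M inst ne hM g f hg hf n t b mn c hn ht htb hb hmn hc
  haveI : Good M := ⟨fun h => comp_of_model hM h, fun h1 h2 h3 => ext_of_model hM h1 h2 h3,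
    fun h => pair_of_model hM h, ne⟩
  obtain ⟨Y, h, _, _, hY, hh, _⟩ := main_of_base base hg hf hn t b mn ht htb hb hmn
  exact ⟨mn, Y, h, (hc.2 mn).2 (eqp_refl mn), hY, hh⟩

end NFUweak
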